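/- (Measure estimate for the good parameter set.) Assume the four unperturbed transversality bounds: for all κ ∈ [κ₁, κ₂], (i) max_{0≤n≤m₀} |∂_κ^n(Ω⃗(κ)·ℓ)| ≥ ρ₀⟨ℓ⟩ for all ℓ ∈ ℤ^ν \ {0}; (ii) max_{0≤n≤m₀} |∂_κ^n(Ω⃗(κ)·ℓ + Ω_j(κ))| ≥ ρ₀⟨ℓ⟩ for all ℓ ∈ ℤ^ν, j ∈ S₀ᶜ with j⃗·ℓ + j = 0; (iii) max_{0≤n≤m₀} |∂_κ^n(Ω⃗(κ)·ℓ + Ω_j(κ) − Ω_{j'}(κ))| ≥ ρ₀⟨ℓ⟩ for all ℓ ∈ ℤ^ν, j, j' ∈ S₀ᶜ with (ℓ,j,j') ≠ (0,j,j) and j⃗·ℓ + j − j' = 0; (iv) max_{0≤n≤m₀} |∂_κ^n(Ω⃗(κ)·ℓ + Ω_j(κ) + Ω_{j'}(κ))| ≥ ρ₀⟨ℓ⟩ for all ℓ ∈ ℤ^ν, j, j' ∈ S₀ᶜ with j⃗·ℓ + j + j' = 0. Set k₀ := m₀ + 2, assume τ > m₀(ν+4), υ = ε^a with 0 < a < 1/(1+k₀).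 Define G_ε as the set of κ ∈ [κ₁, κ₂] such that: |ω⃗_ε(κ)·ℓ| ≥ 8υ⟨ℓ⟩^{−τ} for all ℓ ∈ ℤ^ν \ {0}; |ω⃗_ε(κ)·ℓ + μ_j(κ)| ≥ 4υ|j|^{3/2}⟨ℓ⟩^{−τ} for all ℓ ∈ ℤ^ν, j ∈ S₀ᶜ with j⃗·ℓ + j = 0; |ω⃗_ε(κ)·ℓ + μ_j(κ) − μ_{j'}(κ)| ≥ 4υ⟨|j|^{3/2} − |j'|^{3/2}⟩⟨ℓ⟩^{−τ} for all ℓ ∈ ℤ^ν, j, j' ∈ S₀ᶜ with (ℓ,j,j') ≠ (0,j,j) and j⃗·ℓ + j − j' = 0; and |ω⃗_ε(κ)·ℓ + μ_j(κ) + μ_{j'}(κ)| ≥ 4υ(|j|^{3/2} + |j'|^{3/2})⟨ℓ⟩^{−τ} for all ℓ ∈ ℤ^ν, j, j' ∈ S₀ᶜ with j⃗·ℓ + j + j' = 0. Then there exist ε₀ > 0 and C > 0, depending only on 𝚑, g, γ, κ₁, κ₂, the tangential sites, C₀, τ, a, m₀ and ρ₀, such that for all ε ∈ (0, ε₀) the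 Lebesgue measure of the complement satisfies |[κ₁, κ₂] \ G_ε| ≤ C·ε^{a/m₀}; in particular |G_ε| → κ₂ − κ₁ as ε → 0. -/

import Mathlib

open Real Finset Set

/-- `G_j := j · tanh(dpt · j)` (finite depth `dpt`). -/
noncomputable def Gfun (dpt : ℝ) (j : ℤ) : ℝ := (j : ℝ) * Real.tanh (dpt * (j : ℝ))

/-- The linear frequencies `ω_j(κ)`. -/
noncomputable def omegaF (dpt g γ : ℝ) (j : ℤ) (κ : ℝ) : ℝ :=
  Real.sqrt (κ * Gfun dpt j * (j : ℝ) ^ 2 + g * Gfun dpt j + (γ * Gfun dpt j / (2 * (j : ℝ))) ^ 2)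

/-- The linear frequencies `Ω_j(κ) = ω_j(κ) + (γ/2) G_j / j`. -/
noncomputable def OmegaF (dpt g γ : ℝ) (j : ℤ) (κ : ℝ) : ℝ :=
  omegaF dpt g γ j κ + γ / 2 * Gfun dpt j / (j : ℝ)

/-- The perturbed frequencies μ_j(κ). -/
noncomputable def muF (dpt g γ : ℝ) (m32 m1 m12 : ℝ → ℝ) (r : ℤ → ℝ → ℝ) (j : ℤ) (κ : ℝ) : ℝ :=
  m32 κ * OmegaF dpt g γ j κ + m1 κ * (j : ℝ) + m12 κ * |(j : ℝ)| ^ ((1 : ℝ) / 2) + r j κ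

lemma exists_separated_points {s : ℝ} (hs : 0 < s) (n : ℕ) {E : Set ℝ} (hE : IsCompact E)
    (hv : ENNReal.ofReal (n * s) < MeasureTheory.volume E) :
    ∃ x : ℕ → ℝ, (∀ i ≤ n, x i ∈ E) ∧ ∀ i < n, x i + s ≤ x (i + 1) := by
  induction n generalizing E with
  | zero =>
    obtain ⟨y, hy⟩ : E.Nonempty := by
      by_contra h
      rw [Set.not_nonempty_iff_eq_empty] at h
      simp [h] at hv
    exact ⟨fun _ => y, fun _ _ => hy, fun i hi => absurd hi (Nat.not_lt_zero i)⟩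
  | succ n ih =>
    have hne : E.Nonempty := by
      by_contra h
      rw [Set.not_nonempty_iff_eq_empty] at h
      simp [h] at hv
    obtain ⟨y, hyE, hy⟩ := hE.exists_isLeast hne
    have hE' : IsCompact (E ∩ Set.Ici (y + s)) := hE.inter_right isClosed_Ici
    have hsub : E ⊆ Set.Icc y (y + s) ∪ (E ∩ Set.Ici (y + s)) := by
      intro z hz
      rcases le_total z (y + s) with h | h
      · exact Or.inl ⟨hy hz, h⟩
      · exact Or.inr ⟨hz, h⟩
    have hle := (MeasureTheory.measure_mono hsub).trans
      (MeasureTheory.measure_union_le (μ := MeasureTheory.volume) _ _)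
    rw [Real.volume_Icc, add_sub_cancel_left] at hle
    have hv' : ENNReal.ofReal (n * s) < MeasureTheory.volume (E ∩ Set.Ici (y + s)) := by
      by_contra! hcon
      refine absurd (hv.trans_le (hle.trans (add_le_add le_rfl hcon))) ?_
      rw [← ENNReal.ofReal_add hs.le (by positivity)]
      push_cast
      rw [show s + n * s = (n + 1) * s by ring]
      exact lt_irrefl _
    obtain ⟨x, hx, hgap⟩ := ih hE' hv'
    refine ⟨fun i => Nat.casesOn i y x, ?_, ?_⟩
    · intro i hi
      cases i with
      | zero => exact hyE
      | succ i => exact (hx i (by omega)).1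
    · intro i hi
      cases i with
      | zero => exact (hx 0 (by omega)).2
      | succ i => exact hgap i (by omega)

/-- If `f` is at most `α` at `2 ^ n` points with mutual gaps at least `s`, then its `n`-th
derivative is at most `(2 / s) ^ n * α` somewhere. -/
lemma exists_abs_deriv_le_of_separated_points {c d s : ℝ} (hs : 0 < s) (n : ℕ) {D : ℕ → ℝ → ℝ}
    (hD : ∀ k < n, ∀ x ∈ Set.Icc c d, HasDerivAt (D k) (D (k + 1) x) x) {α : ℝ} {x : ℕ → ℝ}
    (hx : ∀ i < 2 ^ n, x i ∈ Set.Icc c d) (hgap : ∀ i, i + 1 < 2 ^ n → x i + s ≤ x (i + 1))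
    (hα : ∀ i < 2 ^ n, |D 0 (x i)| ≤ α) :
    ∃ ξ ∈ Set.Icc c d, |D n ξ| ≤ (2 / s) ^ n * α := by
  induction n generalizing D α x with
  | zero => exact ⟨x 0, hx 0 (by simp), by simpa using hα 0 (by simp)⟩
  | succ n ih =>
    have hpow : 2 ^ (n + 1) = 2 * 2 ^ n := by ring
    have key : ∀ i, ∃ y, i < 2 ^ n →
        y ∈ Set.Icc (x (2 * i)) (x (2 * i + 1)) ∧ |D 1 y| ≤ 2 / s * α := by
      intro i
      by_cases hi : i < 2 ^ n
      · have h1 := hx (2 * i) (by omega)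
        have h2 := hx (2 * i + 1) (by omega)
        have h3 := hgap (2 * i) (by omega)
        have hlt : x (2 * i) < x (2 * i + 1) := by linarith
        have hsub : Set.Icc (x (2 * i)) (x (2 * i + 1)) ⊆ Set.Icc c d :=
          Set.Icc_subset_Icc h1.1 h2.2
        obtain ⟨y, hy, hyeq⟩ := exists_hasDerivAt_eq_slope (D 0) (D 1) hlt
          (fun z hz => ((hD 0 (by omega) z (hsub hz)).continuousAt).continuousWithinAt)
          (fun z hz => hD 0 (by omega) z (hsub (Set.Ioo_subset_Icc_self hz)))
        refine ⟨y, fun _ => ⟨Set.Ioo_subset_Icc_self hy, ?_⟩⟩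
        have ha := hα (2 * i) (by omega)
        have hb := hα (2 * i + 1) (by omega)
        have hα0 : 0 ≤ α := (abs_nonneg _).trans ha
        have hnum : |D 0 (x (2 * i + 1)) - D 0 (x (2 * i))| ≤ 2 * α :=
          (abs_sub _ _).trans (by linarith)
        rw [hyeq, abs_div, abs_of_pos (sub_pos.mpr hlt), div_mul_eq_mul_div]
        exact div_le_div₀ (by positivity) hnum hs (by linarith)
      · exact ⟨0, fun h => absurd h hi⟩
    choose y hy using key
    obtain ⟨ξ, hξ, hle⟩ := ih (D := fun k => D (k + 1)) (α := 2 / s * α) (x := y)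
      (fun k hk z hz => hD (k + 1) (by omega) z hz)
      (fun i hi => ⟨(hx (2 * i) (by omega)).1.trans (hy i hi).1.1,
        (hy i hi).1.2.trans (hx (2 * i + 1) (by omega)).2⟩)
      (fun i hi => by
        have h1 := (hy i (by omega)).1.2
        have h2 := (hy (i + 1) hi).1.1
        have h3 := hgap (2 * i + 1) (by omega)
        have : 2 * (i + 1) = 2 * i + 1 + 1 := by ring
        rw [this] at h2
        linarith)
      (fun i hi => (hy i hi).2)
    exact ⟨ξ, hξ, hle.trans_eq (by ring)⟩

/-- Sublevel set estimate for a function whose `n`-th derivative is bounded below. -/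
lemma volume_sublevel_le_of_le_abs_deriv {c d : ℝ} {n : ℕ} (hn : 1 ≤ n) {D : ℕ → ℝ → ℝ}
    (hD : ∀ k < n, ∀ x ∈ Set.Icc c d, HasDerivAt (D k) (D (k + 1) x) x) {ρ α : ℝ} (hρ : 0 < ρ)
    (hα : 0 < α) (hlow : ∀ x ∈ Set.Icc c d, ρ ≤ |D n x|) :
    MeasureTheory.volume {x ∈ Set.Icc c d | |D 0 x| ≤ α} ≤
      ENNReal.ofReal (2 ^ (n + 2) * (α / ρ) ^ ((1 : ℝ) / n)) := by
  set t : ℝ := (α / ρ) ^ ((1 : ℝ) / n) with ht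
  have htpos : 0 < t := Real.rpow_pos_of_pos (by positivity) _
  have htn : t ^ n = α / ρ := by
    rw [ht, ← Real.rpow_natCast, ← Real.rpow_mul (by positivity),
      one_div_mul_cancel (by positivity), Real.rpow_one]
  have hcont : ContinuousOn (fun x => |D 0 x|) (Set.Icc c d) := fun z hz =>
    ((hD 0 (by omega) z hz).continuousAt.abs).continuousWithinAt
  have hcomp : IsCompact {x ∈ Set.Icc c d | |D 0 x| ≤ α} :=
    isCompact_Icc.of_isClosed_subset
      (hcont.preimage_isClosed_of_isClosed isClosed_Icc (isClosed_Iic (a := α)))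
      (fun z hz => hz.1)
  by_contra! hcon
  obtain ⟨x, hx, hgap⟩ := exists_separated_points (s := 4 * t) (by positivity) (2 ^ n) hcomp
    (lt_of_eq_of_lt (by push_cast; ring_nf) hcon)
  obtain ⟨ξ, hξ, hle⟩ := exists_abs_deriv_le_of_separated_points (s := 4 * t) (by positivity) n hD
    (fun i hi => (hx i hi.le).1) (fun i hi => hgap i (by omega)) (fun i hi => (hx i hi.le).2)
  have h1 := (hlow ξ hξ).trans hle
  have h2 : (2 / (4 * t)) ^ n * α = ρ / 2 ^ n := by
    rw [show 2 / (4 * t) = 1 / (2 * t) by field_simp; norm_num, div_pow, one_pow, mul_pow, htn]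
    field_simp
  rw [h2, le_div_iff₀ (by positivity)] at h1
  have h3 : (2 : ℝ) ≤ 2 ^ n := by
    calc (2 : ℝ) = 2 ^ 1 := by norm_num
      _ ≤ 2 ^ n := pow_le_pow_right₀ (by norm_num) hn
  nlinarith

/-- Sublevel set estimate for a function which, at each point, has some derivative of order at most
`m` bounded below, while its derivatives of order between `1` and `m + 1` are bounded above. -/
lemma exists_volume_sublevel_le {c d : ℝ} (hcd : c < d) (m : ℕ) {ρ K : ℝ}
    (hρ : 0 < ρ) (hK : 0 < K) :
    ∃ C > (0 : ℝ), ∀ D : ℕ → ℝ → ℝ,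
      (∀ k ≤ m, ∀ x ∈ Set.Icc c d, HasDerivAt (D k) (D (k + 1) x) x) →
      (∀ k ≤ m, ∀ x ∈ Set.Icc c d, |D (k + 1) x| ≤ K) →
      (∀ x ∈ Set.Icc c d, ∃ n ≤ m, ρ ≤ |D n x|) →
      ∀ α : ℝ, 0 < α → α ≤ ρ / 4 →
        MeasureTheory.volume {x ∈ Set.Icc c d | |D 0 x| ≤ α} ≤
          ENNReal.ofReal (C * α ^ ((1 : ℝ) / m)) := by
  obtain ⟨N, hN⟩ := exists_nat_gt (2 * K * (d - c) / ρ)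
  have hN0 : (0 : ℝ) < N := lt_of_le_of_lt (by have := sub_pos.mpr hcd; positivity) hN
  have hdc := sub_pos.mpr hcd
  set η : ℝ := (d - c) / N with hη
  have hη0 : 0 < η := by positivity
  have hKη : K * η ≤ ρ / 2 := by
    rw [div_lt_iff₀ hρ] at hN
    rw [hη, mul_div_assoc', div_le_iff₀ hN0]
    linarith
  have hNη : N * η = d - c := by rw [hη]; field_simp
  refine ⟨N * (2 ^ (m + 2) * (2 / ρ) ^ ((1 : ℝ) / m)), by positivity, ?_⟩
  intro D hD hup hlow α hα hαρ
  have hpiece : ∀ i ∈ Finset.range N,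
      MeasureTheory.volume {x ∈ Set.Icc (c + i * η) (c + i * η + η) | |D 0 x| ≤ α} ≤
        ENNReal.ofReal (2 ^ (m + 2) * (2 / ρ) ^ ((1 : ℝ) / m) * α ^ ((1 : ℝ) / m)) := by
    intro i hi
    have hi' : (i : ℝ) + 1 ≤ N := by exact_mod_cast Finset.mem_range.mp hi
    have hend : c + i * η + η ≤ d := by nlinarith
    have hstart : c ≤ c + i * η := le_add_of_nonneg_right (by positivity)
    have hsub : Set.Icc (c + i * η) (c + i * η + η) ⊆ Set.Icc c d :=
      Set.Icc_subset_Icc hstart hend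
    have hleft : c + i * η ∈ Set.Icc (c + i * η) (c + i * η + η) := ⟨le_rfl, by linarith⟩
    obtain ⟨n, hn, hρn⟩ := hlow _ (hsub hleft)
    have hbd : ∀ x ∈ Set.Icc (c + i * η) (c + i * η + η), ρ / 2 ≤ |D n x| := by
      intro x hx
      have hlip :=
        (convex_Icc (c + i * η) (c + i * η + η)).norm_image_sub_le_of_norm_hasDerivWithin_le
        (fun y hy => (hD n hn y (hsub hy)).hasDerivWithinAt) (fun y hy => hup n hn y (hsub hy))
        hleft hx
      rw [Real.norm_eq_abs, Real.norm_eq_abs, abs_of_nonneg (sub_nonneg.mpr hx.1)] at hlip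
      have h1 : K * (x - (c + i * η)) ≤ K * η :=
        mul_le_mul_of_nonneg_left (by linarith [hx.2]) hK.le
      have h2 := abs_sub_abs_le_abs_sub (D n (c + i * η)) (D n x)
      rw [abs_sub_comm] at h2
      linarith
    rcases Nat.eq_zero_or_pos n with rfl | hn0
    · have hempty : {x ∈ Set.Icc (c + i * η) (c + i * η + η) | |D 0 x| ≤ α} = ∅ := by
        ext x
        simp only [Set.mem_ofPred_eq, Set.mem_empty_iff_false, iff_false, not_and, not_le]
        intro hx
        linarith [hbd x hx]
      rw [hempty, MeasureTheory.measure_empty]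
      exact zero_le
    · refine (volume_sublevel_le_of_le_abs_deriv hn0
        (fun k hk x hx => hD k (by omega) x (hsub hx)) (half_pos hρ) hα hbd).trans ?_
      apply ENNReal.ofReal_le_ofReal
      rw [mul_assoc, ← Real.mul_rpow (by positivity) hα.le]
      have hbase : α / (ρ / 2) = 2 / ρ * α := by field_simp
      rw [hbase]
      have hle1 : 2 / ρ * α ≤ 1 := by
        rw [div_mul_eq_mul_div, div_le_one hρ]; linarith
      apply mul_le_mul
      · exact pow_le_pow_right₀ (by norm_num) (by omega)
      · exact Real.rpow_le_rpow_of_exponent_ge (by positivity) hle1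
          (one_div_le_one_div_of_le (by exact_mod_cast hn0) (by exact_mod_cast hn))
      · positivity
      · positivity
  have hcover : {x ∈ Set.Icc c d | |D 0 x| ≤ α} ⊆
      ⋃ i ∈ Finset.range N, {x ∈ Set.Icc (c + i * η) (c + i * η + η) | |D 0 x| ≤ α} := by
    rintro x ⟨hx, hxα⟩
    simp only [Set.mem_iUnion, Finset.mem_range]
    rcases hx.2.eq_or_lt with rfl | hlt
    · have hN1 : 1 ≤ N := by exact_mod_cast hN0
      refine ⟨N - 1, by omega, ⟨?_, ?_⟩, hxα⟩ <;>
        · push_cast [Nat.cast_sub hN1]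
          linarith
    · have h0 : 0 ≤ (x - c) / η := div_nonneg (by linarith [hx.1]) hη0.le
      have hf := Nat.floor_le h0
      have hf' := Nat.lt_floor_add_one ((x - c) / η)
      rw [le_div_iff₀ hη0] at hf
      rw [div_lt_iff₀ hη0] at hf'
      refine ⟨⌊(x - c) / η⌋₊, ?_, ⟨by linarith, by linarith⟩, hxα⟩
      rw [Nat.floor_lt h0, div_lt_iff₀ hη0]
      linarith
  refine (MeasureTheory.measure_mono hcover).trans
    ((MeasureTheory.measure_biUnion_finset_le _ _).trans ((Finset.sum_le_sum hpiece).trans ?_))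
  rw [Finset.sum_const, Finset.card_range, nsmul_eq_mul, ← ENNReal.ofReal_natCast,
    ← ENNReal.ofReal_mul (by positivity)]
  exact ENNReal.ofReal_le_ofReal (le_of_eq (by ring))

/-- On `s`, the function `f` is `n` times continuously differentiable and its derivatives of order
at most `n` are bounded by `B`. -/
def HasDerivBounds (n : ℕ) (s : Set ℝ) (f : ℝ → ℝ) (B : ℝ) : Prop :=
  ∀ x ∈ s, ContDiffAt ℝ n f x ∧ ∀ k ≤ n, |iteratedDeriv k f x| ≤ B

namespace HasDerivBounds

variable {n : ℕ} {s : Set ℝ} {f h : ℝ → ℝ} {B B' : ℝ}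

lemma mono (hf : HasDerivBounds n s f B) (hB : B ≤ B') : HasDerivBounds n s f B' :=
  fun x hx => ⟨(hf x hx).1, fun k hk => ((hf x hx).2 k hk).trans hB⟩

lemma const_mul (hf : HasDerivBounds n s f B) (c : ℝ) :
    HasDerivBounds n s (fun x => c * f x) (|c| * B) := by
  refine fun x hx => ⟨contDiffAt_const.mul (hf x hx).1, fun k hk => ?_⟩
  rw [iteratedDeriv_const_mul_field, abs_mul]
  exact mul_le_mul_of_nonneg_left ((hf x hx).2 k hk) (abs_nonneg c)

lemma add (hf : HasDerivBounds n s f B) (hh : HasDerivBounds n s h B') :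
    HasDerivBounds n s (fun x => f x + h x) (B + B') := by
  refine fun x hx => ⟨(hf x hx).1.add (hh x hx).1, fun k hk => ?_⟩
  have hk' : (k : WithTop ℕ∞) ≤ n := by exact_mod_cast hk
  rw [iteratedDeriv_fun_add ((hf x hx).1.of_le hk') ((hh x hx).1.of_le hk')]
  exact (abs_add_le _ _).trans (add_le_add ((hf x hx).2 k hk) ((hh x hx).2 k hk))

lemma const (n : ℕ) (s : Set ℝ) (c : ℝ) : HasDerivBounds n s (fun _ => c) |c| := by
  refine fun x _ => ⟨contDiffAt_const, fun k _ => ?_⟩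
  rw [iteratedDeriv_const]
  split_ifs <;> simp

lemma sum {ι : Type*} {I : Finset ι} {f : ι → ℝ → ℝ} {B : ι → ℝ}
    (hf : ∀ i ∈ I, HasDerivBounds n s (f i) (B i)) :
    HasDerivBounds n s (fun x => ∑ i ∈ I, f i x) (∑ i ∈ I, B i) := by
  refine fun x hx => ⟨ContDiffAt.sum fun i hi => (hf i hi x hx).1, fun k hk => ?_⟩
  have hk' : (k : WithTop ℕ∞) ≤ n := by exact_mod_cast hk
  rw [iteratedDeriv_fun_sum fun i hi => (hf i hi x hx).1.of_le hk']
  exact (Finset.abs_sum_le_sum_abs _ _).trans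
    (Finset.sum_le_sum fun i hi => (hf i hi x hx).2 k hk)

lemma mul (hf : HasDerivBounds n s f B) (hh : HasDerivBounds n s h B') :
    HasDerivBounds n s (fun x => f x * h x) (2 ^ n * (B * B')) := by
  refine fun x hx => ⟨(hf x hx).1.mul (hh x hx).1, fun k hk => ?_⟩
  have hk' : (k : WithTop ℕ∞) ≤ n := by exact_mod_cast hk
  have hB : 0 ≤ B := (abs_nonneg _).trans ((hf x hx).2 0 (Nat.zero_le n))
  have hB' : 0 ≤ B' := (abs_nonneg _).trans ((hh x hx).2 0 (Nat.zero_le n))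
  rw [iteratedDeriv_fun_mul ((hf x hx).1.of_le hk') ((hh x hx).1.of_le hk')]
  have hterm : ∀ i ∈ Finset.range (k + 1),
      |(k.choose i : ℝ) * iteratedDeriv i f x * iteratedDeriv (k - i) h x| ≤
        k.choose i * (B * B') := by
    intro i hi
    have hi' := Finset.mem_range.mp hi
    rw [abs_mul, abs_mul, Nat.abs_cast, mul_assoc]
    exact mul_le_mul_of_nonneg_left (mul_le_mul ((hf x hx).2 i (by omega))
      ((hh x hx).2 (k - i) (by omega)) (abs_nonneg _) hB) (Nat.cast_nonneg _)
  refine (Finset.abs_sum_le_sum_abs _ _).trans ((Finset.sum_le_sum hterm).trans ?_)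
  rw [← Finset.sum_mul, ← Nat.cast_sum, Nat.sum_range_choose]
  push_cast
  exact mul_le_mul_of_nonneg_right (pow_le_pow_right₀ (by norm_num) hk) (by positivity)

lemma abs_le (hf : HasDerivBounds n s f B) {x : ℝ} (hx : x ∈ s) : |f x| ≤ B := by
  simpa using (hf x hx).2 0 (Nat.zero_le n)

lemma hasDerivAt_iteratedDeriv (hf : HasDerivBounds n s f B) {k : ℕ} (hk : k < n) {x : ℝ}
    (hx : x ∈ s) : HasDerivAt (iteratedDeriv k f) (iteratedDeriv (k + 1) f x) x := by
  rw [iteratedDeriv_succ]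
  refine DifferentiableAt.hasDerivAt ?_
  rw [iteratedDeriv_eq_equiv_comp]
  exact (LinearIsometryEquiv.differentiableAt _).comp x
    ((hf x hx).1.differentiableAt_iteratedFDeriv (by exact_mod_cast hk))

end HasDerivBounds

lemma exists_hasDerivBounds_sqrt (n : ℕ) {κ₁ : ℝ} (hκ₁ : 0 < κ₁) (κ₂ : ℝ) :
    ∃ M, HasDerivBounds n (Set.Icc κ₁ κ₂) Real.sqrt M := by
  have hsmooth : ∀ x ∈ Set.Icc κ₁ κ₂, ContDiffAt ℝ (n + 1 : ℕ) Real.sqrt x := fun x hx =>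
    Real.contDiffAt_sqrt (hκ₁.trans_le hx.1).ne'
  have hbd : ∀ k : ℕ, ∃ M, 0 ≤ M ∧
      (k ≤ n → ∀ x ∈ Set.Icc κ₁ κ₂, |iteratedDeriv k Real.sqrt x| ≤ M) := by
    intro k
    by_cases hk : k ≤ n
    · have hcont : ContinuousOn (iteratedDeriv k Real.sqrt) (Set.Icc κ₁ κ₂) := by
        intro x hx
        rw [iteratedDeriv_eq_equiv_comp]
        exact ((LinearIsometryEquiv.continuous _).continuousAt.comp
          ((hsmooth x hx).differentiableAt_iteratedFDeriv
            (by exact_mod_cast Nat.lt_succ_of_le hk)).continuousAt).continuousWithinAt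
      obtain ⟨M, hM⟩ := isCompact_Icc.exists_bound_of_continuousOn hcont
      exact ⟨max M 0, le_max_right _ _, fun _ x hx => (hM x hx).trans (le_max_left _ _)⟩
    · exact ⟨0, le_rfl, fun h => absurd h hk⟩
  choose M hM0 hM using hbd
  refine ⟨∑ k ∈ Finset.range (n + 1), M k, fun x hx =>
    ⟨(hsmooth x hx).of_le (by exact_mod_cast Nat.le_succ n), fun k hk => (hM k hk x hx).trans ?_⟩⟩
  exact Finset.single_le_sum (fun i _ => hM0 i) (Finset.mem_range.mpr (Nat.lt_succ_of_le hk))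

/-- Derivative bounds for the increment `√(x + b) - √x`, linear in the shift `b`. -/
lemma HasDerivBounds.sqrt_shift {n : ℕ} {κ₁ κ₂ b₀ M : ℝ} (hκ₁ : 0 < κ₁)
    (hM : HasDerivBounds (n + 1) (Set.Icc κ₁ (κ₂ + b₀)) Real.sqrt M) {b : ℝ} (hb : 0 ≤ b)
    (hb₀ : b ≤ b₀) :
    HasDerivBounds n (Set.Icc κ₁ κ₂) (fun x => Real.sqrt (x + b) - Real.sqrt x) (M * b) := by
  intro x hx
  have hx0 : 0 < x := hκ₁.trans_le hx.1
  have hs : ∀ k : ℕ, ContDiffAt ℝ k Real.sqrt x := fun k => Real.contDiffAt_sqrt hx0.ne'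
  have hsb : ∀ k : ℕ, ContDiffAt ℝ k (fun y => Real.sqrt (y + b)) x := fun k =>
    (Real.contDiffAt_sqrt (by positivity)).comp x (contDiffAt_id.add contDiffAt_const)
  refine ⟨(hsb n).sub (hs n), fun k hk => ?_⟩
  rw [iteratedDeriv_fun_sub (hsb k) (hs k), iteratedDeriv_comp_add_const]
  have h1 : x ∈ Set.Icc κ₁ (κ₂ + b₀) := ⟨hx.1, by linarith [hx.2]⟩
  have h2 : x + b ∈ Set.Icc κ₁ (κ₂ + b₀) := ⟨by linarith [hx.1], by linarith [hx.2]⟩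
  have := (convex_Icc κ₁ (κ₂ + b₀)).norm_image_sub_le_of_norm_hasDerivWithin_le
    (fun y hy => (hM.hasDerivAt_iteratedDeriv (Nat.lt_succ_of_le hk) hy).hasDerivWithinAt)
    (fun y hy => (hM y hy).2 (k + 1) (Nat.succ_le_succ hk)) h1 h2
  rwa [add_sub_cancel_left, Real.norm_eq_abs, Real.norm_eq_abs, abs_of_nonneg hb] at this

lemma one_sub_tanh_le {y : ℝ} (hy : 0 < y) : 1 - Real.tanh y ≤ 1 / y ^ 2 := by
  have h1 : 0 < Real.cosh y := Real.cosh_pos y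
  rw [Real.tanh_eq_sinh_div_cosh, one_sub_div h1.ne', Real.cosh_sub_sinh,
    div_le_div_iff₀ h1 (by positivity), one_mul]
  have h2 : Real.exp y / 2 ≤ Real.cosh y := by
    rw [Real.cosh_eq]; linarith [Real.exp_pos (-y)]
  have h3 := Real.quadratic_le_exp_of_nonneg hy.le
  have h4 : y ≤ Real.exp y / 2 * 2 := by nlinarith
  have h6 : (1 + y + y ^ 2 / 2) ^ 2 ≤ Real.exp y ^ 2 := by gcongr
  rw [Real.exp_neg, inv_mul_le_iff₀ (Real.exp_pos y)]
  nlinarith [Real.exp_pos y, mul_le_mul_of_nonneg_left h2 (Real.exp_pos y).le, pow_pos hy 3,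
    pow_pos hy 4]

lemma Gfun_eq_abs (dpt : ℝ) (j : ℤ) :
    Gfun dpt j = |(j : ℝ)| * Real.tanh (dpt * |(j : ℝ)|) := by
  rcases abs_choice (j : ℝ) with h | h <;> rw [Gfun, h]
  rw [mul_neg, Real.tanh_neg, neg_mul_neg]

/-- The linear frequencies differ from `|j| ^ (3 / 2) * √κ` by a function with derivatives bounded
uniformly in `j`. -/
lemma exists_hasDerivBounds_OmegaF_sub (n : ℕ) {dpt g κ₁ : ℝ} (γ κ₂ : ℝ) (hdpt : 0 < dpt)
    (hg : 0 < g) (hκ₁ : 0 < κ₁) (hκ₁₂ : κ₁ < κ₂) :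
    ∃ B, ∀ j : ℤ, j ≠ 0 → HasDerivBounds n (Set.Icc κ₁ κ₂)
      (fun κ => OmegaF dpt g γ j κ - |(j : ℝ)| ^ ((3 : ℝ) / 2) * Real.sqrt κ) B := by
  set b₀ := g + γ ^ 2 / 4 with hb₀
  have hb₀0 : 0 < b₀ := by positivity
  obtain ⟨M, hM⟩ := exists_hasDerivBounds_sqrt (n + 1) hκ₁ (κ₂ + b₀)
  have hM0 : 0 ≤ M := (abs_nonneg _).trans (hM.abs_le ⟨le_rfl, by linarith⟩)
  have hM' : HasDerivBounds n (Set.Icc κ₁ κ₂) Real.sqrt M := fun x hx =>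
    have hx' : x ∈ Set.Icc κ₁ (κ₂ + b₀) := ⟨hx.1, by linarith [hx.2]⟩
    ⟨(hM x hx').1.of_le (by exact_mod_cast Nat.le_succ n),
      fun k hk => (hM x hx').2 k (hk.trans (Nat.le_succ n))⟩
  refine ⟨b₀ * M + 1 / dpt ^ 2 * M + |γ| / 2, fun j hj => ?_⟩
  set y : ℝ := |(j : ℝ)| with hy
  have hy1 : 1 ≤ y := by
    rw [hy]; exact_mod_cast Int.one_le_abs hj
  have hy0 : 0 < y := by linarith
  have hj2 : (j : ℝ) ^ 2 = y ^ 2 := (sq_abs _).symm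
  have hj0 : (j : ℝ) ≠ 0 := by exact_mod_cast hj
  set θ := Real.tanh (dpt * y) with hθ
  have hθ0 : 0 < θ := by
    rw [hθ, Real.tanh_eq_sinh_div_cosh]
    exact div_pos (Real.sinh_pos_iff.mpr (by positivity)) (Real.cosh_pos _)
  have hθ1 : θ ≤ 1 := (Real.tanh_lt_one _).le
  have hG : Gfun dpt j = y * θ := Gfun_eq_abs dpt j
  set T : ℝ := y ^ ((3 : ℝ) / 2) with hT
  have hT0 : 0 < T := Real.rpow_pos_of_pos hy0 _
  have hT2 : T ^ 2 = y ^ 3 := by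
    rw [hT, ← Real.rpow_natCast, ← Real.rpow_mul hy0.le, ← Real.rpow_natCast]; norm_num
  have hTy : T ≤ y ^ 2 := by
    rw [hT, ← Real.rpow_natCast]
    exact Real.rpow_le_rpow_of_exponent_le hy1 (by norm_num)
  set A := y ^ 3 * θ with hA
  have hA0 : 0 < A := by positivity
  set b := (g + γ ^ 2 / 4 * θ / y) / y ^ 2 with hb
  have hb0 : 0 ≤ b := by positivity
  have hnum : g + γ ^ 2 / 4 * θ / y ≤ b₀ := by
    have : γ ^ 2 / 4 * θ / y ≤ γ ^ 2 / 4 := by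
      rw [div_le_iff₀ hy0]
      exact mul_le_mul_of_nonneg_left (hθ1.trans hy1) (by positivity)
    linarith
  have hbb : b * y ^ 2 ≤ b₀ := by
    rw [hb, div_mul_cancel₀ _ (by positivity)]; exact hnum
  have hbb₀ : b ≤ b₀ := by
    have : b * 1 ≤ b * y ^ 2 := by gcongr; nlinarith
    linarith
  have hsqrtA : Real.sqrt A = T * Real.sqrt θ := by
    rw [hA, Real.sqrt_mul (by positivity), ← hT2, Real.sqrt_sq hT0.le]
  have hsθ : θ ≤ Real.sqrt θ := Real.le_sqrt_of_sq_le (by nlinarith)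
  have hsθ1 : Real.sqrt θ ≤ 1 := Real.sqrt_le_one.mpr hθ1
  have hAT : |Real.sqrt A - T| ≤ 1 / dpt ^ 2 := by
    have h1 : 1 - θ ≤ 1 / (dpt * y) ^ 2 := one_sub_tanh_le (by positivity)
    have h2 : y ^ 2 * (1 / (dpt * y) ^ 2) = 1 / dpt ^ 2 := by field_simp
    rw [hsqrtA, abs_sub_comm, abs_of_nonneg (by nlinarith)]
    calc T - T * Real.sqrt θ = T * (1 - Real.sqrt θ) := by ring
      _ ≤ y ^ 2 * (1 / (dpt * y) ^ 2) :=
        mul_le_mul hTy (by linarith) (by linarith) (by positivity)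
      _ = 1 / dpt ^ 2 := h2
  have hfun : (fun κ => OmegaF dpt g γ j κ - T * Real.sqrt κ) = fun κ =>
      Real.sqrt A * (Real.sqrt (κ + b) - Real.sqrt κ) + (Real.sqrt A - T) * Real.sqrt κ
        + γ / 2 * (y * θ) / j := by
    funext κ
    have harg : κ * (y * θ) * (j : ℝ) ^ 2 + g * (y * θ) + (γ * (y * θ) / (2 * (j : ℝ))) ^ 2 =
        A * (κ + b) := by
      rw [div_pow, mul_pow 2 (j : ℝ), hj2, hA, hb]
      field_simp
      ring
    rw [OmegaF, omegaF, hG, harg, Real.sqrt_mul hA0.le]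
    ring
  rw [hfun]
  refine ((((hM.sqrt_shift hκ₁ hb0 hbb₀).const_mul _).add (hM'.const_mul _)).add
    (HasDerivBounds.const n _ _)).mono ?_
  refine add_le_add (add_le_add ?_ (mul_le_mul_of_nonneg_right hAT hM0)) ?_
  · rw [abs_of_nonneg (Real.sqrt_nonneg _)]
    have h1 : Real.sqrt A ≤ y ^ 2 := by rw [hsqrtA]; nlinarith
    calc Real.sqrt A * (M * b) ≤ y ^ 2 * (M * b) := by gcongr
      _ = b * y ^ 2 * M := by ring
      _ ≤ b₀ * M := by gcongr
  · rw [abs_div, abs_mul, abs_of_pos (by positivity : 0 < y * θ), ← hy, div_le_iff₀ hy0, abs_div,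
      abs_of_pos (by norm_num : (0 : ℝ) < 2)]
    have : y * θ ≤ y := by nlinarith
    gcongr

lemma mul_abs_le_of_small_divisor {N J B η q υ L S P H : ℝ} (hN : 0 ≤ N) (hJ : 0 ≤ J) (hB : 0 ≤ B)
    (hη1 : η ≤ 1 / 2) (hηq : η ≤ q / 8) (hυ1 : υ ≤ 1) (hυq : υ ≤ q / 64) (hL : 1 ≤ L)
    (hP : |P| ≤ J * L) (hH : |H| ≤ |S|) {s Om E W R M m1 m12 : ℝ} (hqs : q ≤ s) (hq : 0 ≤ q)
    (bOm : |Om| ≤ N * L) (bE : |E| ≤ B) (bW : |W| ≤ N * η * L) (bR : |R| ≤ N * η) (bM : |M| ≤ η)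
    (bm1 : |m1| ≤ η) (bm12 : |m12| ≤ η)
    (hf : |Om + (S * s + E) + (W + M * (S * s + E) + P * m1 + H * m12 + R)| ≤ 8 * υ * (1 + |S|)) :
    q / 4 * |S| ≤ (B + 8 + 3 * N + J) * L := by
  have hL0 : 0 ≤ L := by linarith
  set F := S * s + E with hF
  set f := Om + F + (W + M * F + P * m1 + H * m12 + R) with hfdef
  have hFlow : q * |S| - B ≤ |F| := by
    have h1 : |S * s| ≤ |F| + |E| := by
      rw [show S * s = F - E by rw [hF]; ring]
      exact abs_sub _ _
    rw [abs_mul, abs_of_nonneg (hq.trans hqs)] at h1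
    have h3 : q * |S| ≤ |S| * s := by rw [mul_comm]; gcongr
    linarith
  have hMF : |M * F| ≤ 1 / 2 * |F| := by
    rw [abs_mul]
    exact mul_le_mul_of_nonneg_right (bM.trans hη1) (abs_nonneg _)
  have hPm : |P * m1| ≤ J * L * η := by
    rw [abs_mul]
    exact mul_le_mul hP bm1 (abs_nonneg _) (by positivity)
  have hHm : |H * m12| ≤ |S| * η := by
    rw [abs_mul]
    exact mul_le_mul hH bm12 (abs_nonneg _) (by positivity)
  have hdecomp : F = f - Om - W - M * F - P * m1 - H * m12 - R := by
    rw [hfdef]; ring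
  have htri : |F| ≤ |f| + |Om| + |W| + |M * F| + |P * m1| + |H * m12| + |R| := by
    conv_lhs => rw [hdecomp]
    refine (abs_sub _ _).trans (add_le_add ?_ le_rfl)
    refine (abs_sub _ _).trans (add_le_add ?_ le_rfl)
    refine (abs_sub _ _).trans (add_le_add ?_ le_rfl)
    refine (abs_sub _ _).trans (add_le_add ?_ le_rfl)
    refine (abs_sub _ _).trans (add_le_add ?_ le_rfl)
    exact abs_sub _ _
  have h4 : N * η * L ≤ 1 / 2 * (N * L) := by
    calc N * η * L = η * (N * L) := by ring
      _ ≤ 1 / 2 * (N * L) := by gcongr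
  have h5 : J * L * η ≤ J * L * (1 / 2) := by gcongr
  have h6 : N * η ≤ N * L := by gcongr; linarith
  have h7 : |S| * η ≤ |S| * (q / 8) := by gcongr
  have h8 : υ * |S| ≤ q / 64 * |S| := by gcongr
  have h9 : B ≤ B * L := le_mul_of_one_le_right hB hL
  have h10 : 0 ≤ N * L := by positivity
  have h11 : 0 ≤ J * L := by positivity
  have h12 : 0 ≤ B * L := by positivity
  clear_value f F
  linarith

/-- Measure of a single resonant set. The perturbed divisor is
`Om + F + W + M * F + P * m1 + H * m12 + R` with `F = S * √κ + E`, where `Om + F` is the unperturbed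
divisor and all remaining terms have derivatives of size `η`. A nonempty resonant set forces
`|S| ≤ Q * L`, and its measure is then controlled by the transversality of `Om + F`. -/
lemma exists_volume_resonant_le {κ₁ κ₂ : ℝ} (hκ₁ : 0 < κ₁) (hκ₁₂ : κ₁ < κ₂) (m : ℕ)
    {ρ₀ N J B : ℝ} (hρ₀ : 0 < ρ₀) (hN : 0 ≤ N) (hJ : 0 ≤ J) (hB : 0 ≤ B) :
    ∃ η₀ > (0 : ℝ), ∃ υ₀ > (0 : ℝ), ∃ C > (0 : ℝ), ∃ Q > (0 : ℝ), ∀ η υ : ℝ, 0 ≤ η → η ≤ η₀ →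
      0 < υ → υ ≤ υ₀ → ∀ L S P H w : ℝ, 1 ≤ L → |P| ≤ J * L → |H| ≤ |S| → 0 < w → w ≤ 1 →
      ∀ Om E W R M m1 m12 : ℝ → ℝ,
      HasDerivBounds (m + 1) (Set.Icc κ₁ κ₂) Om (N * L) →
      HasDerivBounds (m + 1) (Set.Icc κ₁ κ₂) E B →
      HasDerivBounds (m + 1) (Set.Icc κ₁ κ₂) W (N * η * L) →
      HasDerivBounds (m + 1) (Set.Icc κ₁ κ₂) R (N * η) →
      HasDerivBounds (m + 1) (Set.Icc κ₁ κ₂) M η →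
      HasDerivBounds (m + 1) (Set.Icc κ₁ κ₂) m1 η →
      HasDerivBounds (m + 1) (Set.Icc κ₁ κ₂) m12 η →
      (∀ κ ∈ Set.Icc κ₁ κ₂, ∃ n ≤ m,
        ρ₀ * L ≤ |iteratedDeriv n (fun κ' => Om κ' + (S * Real.sqrt κ' + E κ')) κ|) →
      ∀ f : ℝ → ℝ, (∀ κ, f κ = Om κ + (S * Real.sqrt κ + E κ) + (W κ
        + M κ * (S * Real.sqrt κ + E κ) + P * m1 κ + H * m12 κ + R κ)) →
      ({κ ∈ Set.Icc κ₁ κ₂ | |f κ| ≤ 8 * υ * max 1 |S| * w}.Nonempty → |S| ≤ Q * L) ∧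
      MeasureTheory.volume {κ ∈ Set.Icc κ₁ κ₂ | |f κ| ≤ 8 * υ * max 1 |S| * w} ≤
        ENNReal.ofReal (C * (υ * w) ^ ((1 : ℝ) / m)) := by
  obtain ⟨Ms, hMs⟩ := exists_hasDerivBounds_sqrt (m + 1) hκ₁ κ₂
  have hMs0 : 0 ≤ Ms := (abs_nonneg _).trans (hMs.abs_le ⟨le_rfl, hκ₁₂.le⟩)
  set q := Real.sqrt κ₁ with hq
  have hq0 : 0 < q := Real.sqrt_pos.mpr hκ₁
  set Q : ℝ := 4 / q * (B + 8 + 3 * N + J) with hQ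
  have hQ0 : 0 < Q := by positivity
  set c : ℝ := 2 * N + 2 ^ (m + 1) * (Q * Ms + B) + J + Q with hc
  have hc0 : 0 < c := by positivity
  set K : ℝ := N + Q * Ms + B + c with hK
  have hK0 : 0 < K := by positivity
  obtain ⟨C, hC, hvol⟩ := exists_volume_sublevel_le hκ₁₂ m (half_pos hρ₀) hK0
  set η₀ : ℝ := min (min (1 / 2) (q / 8)) (ρ₀ / (2 * c)) with hη₀
  set υ₀ : ℝ := min (min 1 (q / 64)) (ρ₀ / (64 * (1 + Q))) with hυ₀
  refine ⟨η₀, by positivity, υ₀, by positivity, C * (8 * (1 + Q)) ^ ((1 : ℝ) / m), by positivity,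
    Q, hQ0, ?_⟩
  intro η υ hη hηle hυ hυle L S P H w hL hP hH hw hw1 Om E W R M m1 m12 bOm bE bW bR bM bm1 bm12
    htrans f hf
  have hη1 : η ≤ 1 / 2 := hηle.trans ((min_le_left _ _).trans (min_le_left _ _))
  have hηq : η ≤ q / 8 := hηle.trans ((min_le_left _ _).trans (min_le_right _ _))
  have hηc : η ≤ ρ₀ / (2 * c) := hηle.trans (min_le_right _ _)
  have hυ1 : υ ≤ 1 := hυle.trans ((min_le_left _ _).trans (min_le_left _ _))
  have hυq : υ ≤ q / 64 := hυle.trans ((min_le_left _ _).trans (min_le_right _ _))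
  have hυρ : υ ≤ ρ₀ / (64 * (1 + Q)) := hυle.trans (min_le_right _ _)
  have hL0 : 0 < L := by linarith
  have hbound : {κ ∈ Set.Icc κ₁ κ₂ | |f κ| ≤ 8 * υ * max 1 |S| * w}.Nonempty → |S| ≤ Q * L := by
    rintro ⟨κ, hκ, hfκ⟩
    have hqκ : q ≤ Real.sqrt κ := Real.sqrt_le_sqrt hκ.1
    rw [hQ, div_mul_eq_mul_div, div_mul_eq_mul_div, le_div_iff₀ hq0]
    have hfκ' : |f κ| ≤ 8 * υ * (1 + |S|) := by
      refine hfκ.trans ((mul_le_of_le_one_right (by positivity) hw1).trans ?_)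
      exact mul_le_mul_of_nonneg_left
        (max_le (by linarith [abs_nonneg S]) (by linarith)) (by positivity)
    have := mul_abs_le_of_small_divisor hN hJ hB hη1 hηq hυ1 hυq hL hP hH hqκ hq0.le
      (bOm.abs_le hκ) (bE.abs_le hκ) (bW.abs_le hκ) (bR.abs_le hκ) (bM.abs_le hκ) (bm1.abs_le hκ)
      (bm12.abs_le hκ) ((hf κ) ▸ hfκ')
    linarith
  refine ⟨hbound, ?_⟩
  rcases Set.eq_empty_or_nonempty {κ ∈ Set.Icc κ₁ κ₂ | |f κ| ≤ 8 * υ * max 1 |S| * w} with he | hne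
  · rw [he, MeasureTheory.measure_empty]
    exact zero_le
  have hS := hbound hne
  have hfun : f = fun κ => (Om κ + (S * Real.sqrt κ + E κ)) + (W κ
        + M κ * (S * Real.sqrt κ + E κ) + P * m1 κ + H * m12 κ + R κ) := funext hf
  have bF : HasDerivBounds (m + 1) (Set.Icc κ₁ κ₂) (fun κ => S * Real.sqrt κ + E κ)
      ((Q * Ms + B) * L) := by
    refine ((hMs.const_mul S).add bE).mono ?_
    have h1 : |S| * Ms ≤ Q * L * Ms := by gcongr
    have h2 : B ≤ B * L := le_mul_of_one_le_right hB hL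
    linarith
  have b0 := bOm.add bF
  have bpert := ((((bW.add (bM.mul bF)).add (bm1.const_mul P)).add (bm12.const_mul H)).add bR).mono
    (B' := c * η * L) (by
      have h1 : |P| * η ≤ J * L * η := by gcongr
      have h2 : |H| * η ≤ Q * L * η := by gcongr; exact hH.trans hS
      have h3 : N * η ≤ N * η * L := le_mul_of_one_le_right (by positivity) hL
      rw [hc]
      linarith)
  have bf := b0.add bpert
  rw [← hfun] at bf
  have hsub : {κ ∈ Set.Icc κ₁ κ₂ | |f κ| ≤ 8 * υ * max 1 |S| * w} ⊆
      {κ ∈ Set.Icc κ₁ κ₂ | |L⁻¹ * iteratedDeriv 0 f κ| ≤ 8 * (1 + Q) * (υ * w)} := by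
    rintro κ ⟨hκ, hfκ⟩
    refine ⟨hκ, ?_⟩
    rw [iteratedDeriv_zero, abs_mul, abs_inv, abs_of_pos hL0, inv_mul_le_iff₀ hL0]
    have h1 : max 1 |S| ≤ (1 + Q) * L := max_le (by nlinarith) (by linarith)
    calc |f κ| ≤ 8 * υ * max 1 |S| * w := hfκ
      _ ≤ 8 * υ * ((1 + Q) * L) * w := by gcongr
      _ = L * (8 * (1 + Q) * (υ * w)) := by ring
  have hup : ∀ k ≤ m, ∀ x ∈ Set.Icc κ₁ κ₂, |L⁻¹ * iteratedDeriv (k + 1) f x| ≤ K := by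
    intro k hk x hx
    rw [abs_mul, abs_inv, abs_of_pos hL0, inv_mul_le_iff₀ hL0]
    refine ((bf x hx).2 (k + 1) (by omega)).trans ?_
    have : c * η * L ≤ c * 1 * L := by gcongr; linarith
    rw [hK]
    linarith
  have hlow : ∀ x ∈ Set.Icc κ₁ κ₂, ∃ n ≤ m, ρ₀ / 2 ≤ |L⁻¹ * iteratedDeriv n f x| := by
    intro x hx
    obtain ⟨n, hn, hρ⟩ := htrans x hx
    refine ⟨n, hn, ?_⟩
    have hn' : ((n : ℕ) : WithTop ℕ∞) ≤ (m + 1 : ℕ) := by exact_mod_cast hn.trans (Nat.le_succ m)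
    rw [abs_mul, abs_inv, abs_of_pos hL0, le_inv_mul_iff₀ hL0, hfun,
      iteratedDeriv_fun_add ((b0 x hx).1.of_le hn') ((bpert x hx).1.of_le hn')]
    have h1 := (bpert x hx).2 n (by omega)
    have h2 : c * η * L ≤ ρ₀ / 2 * L := by
      gcongr
      rw [le_div_iff₀ (by positivity)] at hηc
      linarith
    have h3 := abs_sub_abs_le_abs_add
      (iteratedDeriv n (fun κ' => Om κ' + (S * Real.sqrt κ' + E κ')) x)
      (iteratedDeriv n
        (fun κ => W κ + M κ * (S * Real.sqrt κ + E κ) + P * m1 κ + H * m12 κ + R κ) x)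
    linarith
  refine (MeasureTheory.measure_mono hsub).trans ((hvol (fun k x => L⁻¹ * iteratedDeriv k f x)
    (fun k hk x hx => (bf.hasDerivAt_iteratedDeriv (by omega) hx).const_mul _) hup hlow
    (8 * (1 + Q) * (υ * w)) (by positivity) ?_).trans ?_)
  · rw [le_div_iff₀ (by positivity)] at hυρ
    have : υ * w ≤ υ := mul_le_of_le_one_right hυ.le hw1
    nlinarith
  · rw [Real.mul_rpow (by positivity) (by positivity), mul_assoc]

lemma exists_hasDerivBounds_OmegaF (n : ℕ) {dpt g κ₁ : ℝ} (γ κ₂ : ℝ) (hdpt : 0 < dpt)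
    (hg : 0 < g) (hκ₁ : 0 < κ₁) (hκ₁₂ : κ₁ < κ₂) {j : ℤ} (hj : j ≠ 0) :
    ∃ B, HasDerivBounds n (Set.Icc κ₁ κ₂) (OmegaF dpt g γ j) B := by
  obtain ⟨B, hB⟩ := exists_hasDerivBounds_OmegaF_sub n γ κ₂ hdpt hg hκ₁ hκ₁₂
  obtain ⟨M, hM⟩ := exists_hasDerivBounds_sqrt n hκ₁ κ₂
  have h := (hB j hj).add (hM.const_mul (|(j : ℝ)| ^ ((3 : ℝ) / 2)))
  simp only [sub_add_cancel] at h
  exact ⟨_, h⟩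

lemma abs_intCast_le_max_one_norm {ν : ℕ} (ℓ : Fin ν → ℤ) (b : Fin ν) :
    |(ℓ b : ℝ)| ≤ max 1 ‖ℓ‖ :=
  ((Int.norm_eq_abs (ℓ b)).symm.le.trans (norm_le_pi_norm ℓ b)).trans (le_max_right _ _)

lemma HasDerivBounds.sum_int_mul {n ν : ℕ} {s : Set ℝ} {f : Fin ν → ℝ → ℝ} {B : Fin ν → ℝ}
    (hB : ∀ b, 0 ≤ B b) (hf : ∀ b, HasDerivBounds n s (f b) (B b)) (ℓ : Fin ν → ℤ) :
    HasDerivBounds n s (fun κ => ∑ b, (ℓ b : ℝ) * f b κ) ((∑ b, B b) * max 1 ‖ℓ‖) := by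
  refine (HasDerivBounds.sum fun b _ => (hf b).const_mul (ℓ b : ℝ)).mono ?_
  rw [Finset.sum_mul]
  refine Finset.sum_le_sum fun b _ => ?_
  rw [mul_comm (B b)]
  exact mul_le_mul_of_nonneg_right (abs_intCast_le_max_one_norm ℓ b) (hB b)

/-- Measure of the resonant set of a perturbed divisor involving two normal frequencies. -/
lemma exists_volume_divisor_le {dpt g κ₁ κ₂ : ℝ} (γ : ℝ) (hdpt : 0 < dpt) (hg : 0 < g)
    (hκ₁ : 0 < κ₁) (hκ₁₂ : κ₁ < κ₂) {ν : ℕ} {jbar : Fin ν → ℤ} (hjne : ∀ b, jbar b ≠ 0) (m : ℕ)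
    {ρ₀ J : ℝ} (hρ₀ : 0 < ρ₀) (hJ : 0 ≤ J) :
    ∃ η₀ > (0 : ℝ), ∃ υ₀ > (0 : ℝ), ∃ C > (0 : ℝ), ∃ Q > (0 : ℝ), ∀ η υ : ℝ, 0 ≤ η → η ≤ η₀ →
      0 < υ → υ ≤ υ₀ → ∀ (m32 m1 m12 : ℝ → ℝ) (r : ℤ → ℝ → ℝ) (ωε : ℝ → Fin ν → ℝ),
      HasDerivBounds (m + 1) (Set.Icc κ₁ κ₂) (fun κ => m32 κ - 1) η →
      HasDerivBounds (m + 1) (Set.Icc κ₁ κ₂) m1 η →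
      HasDerivBounds (m + 1) (Set.Icc κ₁ κ₂) m12 η →
      (∀ b, HasDerivBounds (m + 1) (Set.Icc κ₁ κ₂)
        (fun κ => ωε κ b - OmegaF dpt g γ (jbar b) κ) η) →
      ∀ (ℓ : Fin ν → ℤ) (σ σ' : ℝ) (j j' : ℤ) (w : ℝ), |σ| ≤ 1 → |σ'| ≤ 1 → j ≠ 0 → j' ≠ 0 →
      0 < w → w ≤ 1 →
      HasDerivBounds (m + 1) (Set.Icc κ₁ κ₂) (fun κ => σ * r j κ + σ' * r j' κ) (2 * η) →
      |σ * j + σ' * j'| ≤ J * max 1 ‖ℓ‖ →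
      |σ * |(j : ℝ)| ^ ((1 : ℝ) / 2) + σ' * |(j' : ℝ)| ^ ((1 : ℝ) / 2)| ≤
        |σ * |(j : ℝ)| ^ ((3 : ℝ) / 2) + σ' * |(j' : ℝ)| ^ ((3 : ℝ) / 2)| →
      (∀ κ ∈ Set.Icc κ₁ κ₂, ∃ n ≤ m, ρ₀ * max 1 ‖ℓ‖ ≤
        |iteratedDeriv n (fun κ' => (∑ b, (ℓ b : ℝ) * OmegaF dpt g γ (jbar b) κ') +
          (σ * OmegaF dpt g γ j κ' + σ' * OmegaF dpt g γ j' κ')) κ|) →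
      ({κ ∈ Set.Icc κ₁ κ₂ | |(∑ b, (ℓ b : ℝ) * ωε κ b) +
          (σ * muF dpt g γ m32 m1 m12 r j κ + σ' * muF dpt g γ m32 m1 m12 r j' κ)| ≤
          8 * υ * max 1 |σ * |(j : ℝ)| ^ ((3 : ℝ) / 2) + σ' * |(j' : ℝ)| ^ ((3 : ℝ) / 2)| *
          w}.Nonempty →
        |σ * |(j : ℝ)| ^ ((3 : ℝ) / 2) + σ' * |(j' : ℝ)| ^ ((3 : ℝ) / 2)| ≤ Q * max 1 ‖ℓ‖) ∧
      MeasureTheory.volume {κ ∈ Set.Icc κ₁ κ₂ | |(∑ b, (ℓ b : ℝ) * ωε κ b) +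
          (σ * muF dpt g γ m32 m1 m12 r j κ + σ' * muF dpt g γ m32 m1 m12 r j' κ)| ≤
          8 * υ * max 1 |σ * |(j : ℝ)| ^ ((3 : ℝ) / 2) + σ' * |(j' : ℝ)| ^ ((3 : ℝ) / 2)| * w} ≤
        ENNReal.ofReal (C * (υ * w) ^ ((1 : ℝ) / m)) := by
  obtain ⟨BE, hBE⟩ := exists_hasDerivBounds_OmegaF_sub (m + 1) γ κ₂ hdpt hg hκ₁ hκ₁₂
  have hκmem : κ₁ ∈ Set.Icc κ₁ κ₂ := ⟨le_rfl, hκ₁₂.le⟩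
  have hBE0 : 0 ≤ BE := (abs_nonneg _).trans ((hBE 1 one_ne_zero).abs_le hκmem)
  choose BΩ hBΩ using fun b => exists_hasDerivBounds_OmegaF (m + 1) γ κ₂ hdpt hg hκ₁ hκ₁₂ (hjne b)
  have hBΩ0 : ∀ b, 0 ≤ BΩ b := fun b => (abs_nonneg _).trans ((hBΩ b).abs_le hκmem)
  have hsum0 : 0 ≤ ∑ b, BΩ b := Finset.sum_nonneg fun b _ => hBΩ0 b
  set N : ℝ := (∑ b, BΩ b) + ν + 2 with hN
  obtain ⟨η₀, hη₀, υ₀, hυ₀, C, hC, Q, hQ, h⟩ := exists_volume_resonant_le (N := N) hκ₁ hκ₁₂ m hρ₀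
    (by positivity) hJ (by positivity : 0 ≤ BE + BE)
  refine ⟨η₀, hη₀, υ₀, hυ₀, C, hC, Q, hQ, ?_⟩
  intro η υ hη hηle hυ hυle m32 m1 m12 r ωε bM bm1 bm12 bω ℓ σ σ' j j' w hσ hσ' hj hj' hw hw1 bR hP
    hH htrans
  have hL : (1 : ℝ) ≤ max 1 ‖ℓ‖ := le_max_left _ _
  have hL0 : (0 : ℝ) < max 1 ‖ℓ‖ := by linarith
  refine h η υ hη hηle hυ hυle (max 1 ‖ℓ‖) _ _ _ w hL hP hH hw hw1
    (fun κ => ∑ b, (ℓ b : ℝ) * OmegaF dpt g γ (jbar b) κ)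
    (fun κ => σ * (OmegaF dpt g γ j κ - |(j : ℝ)| ^ ((3 : ℝ) / 2) * Real.sqrt κ) +
      σ' * (OmegaF dpt g γ j' κ - |(j' : ℝ)| ^ ((3 : ℝ) / 2) * Real.sqrt κ))
    (fun κ => ∑ b, (ℓ b : ℝ) * (ωε κ b - OmegaF dpt g γ (jbar b) κ))
    (fun κ => σ * r j κ + σ' * r j' κ) (fun κ => m32 κ - 1) m1 m12 ?_ ?_ ?_ ?_ bM bm1 bm12 ?_ _ ?_
  · refine (HasDerivBounds.sum_int_mul hBΩ0 hBΩ ℓ).mono ?_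
    gcongr
    rw [hN]
    linarith [Nat.cast_nonneg (α := ℝ) ν]
  · exact (((hBE j hj).const_mul σ).add ((hBE j' hj').const_mul σ')).mono
      (add_le_add (mul_le_of_le_one_left hBE0 hσ) (mul_le_of_le_one_left hBE0 hσ'))
  · refine (HasDerivBounds.sum_int_mul (fun _ => hη) bω ℓ).mono ?_
    rw [Finset.sum_const, Finset.card_univ, Fintype.card_fin, nsmul_eq_mul]
    gcongr
    rw [hN]
    linarith
  · refine bR.mono ?_
    gcongr
    rw [hN]
    linarith [Nat.cast_nonneg (α := ℝ) ν]
  · intro κ hκ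
    obtain ⟨n, hn, hρ⟩ := htrans κ hκ
    refine ⟨n, hn, hρ.trans_eq ?_⟩
    congr 2
    funext κ'
    ring
  · intro κ
    have hsum : ∑ b, (ℓ b : ℝ) * ωε κ b = (∑ b, (ℓ b : ℝ) * OmegaF dpt g γ (jbar b) κ) +
        ∑ b, (ℓ b : ℝ) * (ωε κ b - OmegaF dpt g γ (jbar b) κ) := by
      rw [← Finset.sum_add_distrib]
      exact Finset.sum_congr rfl fun b _ => by ring
    rw [hsum, muF, muF]
    ring

lemma exists_forall_rpow_le {t δ : ℝ} (ht : 0 < t) (hδ : 0 < δ) :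
    ∃ ε₀ > (0 : ℝ), ∀ ε, 0 < ε → ε < ε₀ → ε ^ t ≤ δ := by
  refine ⟨δ ^ (1 / t), Real.rpow_pos_of_pos hδ _, fun ε hε hlt => ?_⟩
  calc ε ^ t ≤ (δ ^ (1 / t)) ^ t := Real.rpow_le_rpow hε.le hlt.le ht.le
    _ = δ := by rw [← Real.rpow_mul hδ.le, one_div_mul_cancel ht.ne', Real.rpow_one]

lemma summable_max_one_norm_rpow (ν : ℕ) {p : ℝ} (hp : (ν : ℝ) < p) :
    Summable fun ℓ : Fin ν → ℤ => (max 1 ‖ℓ‖ : ℝ) ^ (-p) := by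
  set Λ : Submodule ℤ (Fin ν → ℝ) := Submodule.span ℤ (Set.range (Pi.basisFun ℝ (Fin ν))) with hΛ
  have hrank : Module.finrank ℤ Λ = ν := by
    rw [ZLattice.rank ℝ Λ, Module.finrank_fin_fun]
  have hs := ZLattice.summable_norm_rpow Λ (-p) (by rw [hrank]; linarith)
  have hmem : ∀ ℓ : Fin ν → ℤ, (fun b => (ℓ b : ℝ)) ∈ Λ := by
    intro ℓ
    rw [hΛ, (Pi.basisFun ℝ (Fin ν)).mem_span_iff_repr_mem ℤ]
    intro b
    exact ⟨ℓ b, by simp⟩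
  have hinj : Function.Injective fun ℓ : Fin ν → ℤ => (⟨fun b => (ℓ b : ℝ), hmem ℓ⟩ : Λ) := by
    intro ℓ ℓ' h
    funext b
    have : (ℓ b : ℝ) = (ℓ' b : ℝ) := congrFun (Subtype.ext_iff.mp h) b
    exact_mod_cast this
  have hs' := hs.comp_injective hinj
  have hnorm : ∀ ℓ : Fin ν → ℤ, ‖(⟨fun b => (ℓ b : ℝ), hmem ℓ⟩ : Λ)‖ = ‖ℓ‖ := by
    intro ℓ
    rw [Submodule.coe_norm, Pi.norm_def, Pi.norm_def]
    congr 2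
  refine Summable.of_norm_bounded_eventually hs' ?_
  refine (Set.finite_singleton (0 : Fin ν → ℤ)).subset fun ℓ hℓ => ?_
  by_contra h0
  refine hℓ ?_
  have h1 : 1 ≤ ‖ℓ‖ := by
    obtain ⟨b, hb⟩ : ∃ b, ℓ b ≠ 0 := by
      by_contra! hcon
      exact h0 (funext hcon)
    refine le_trans ?_ (norm_le_pi_norm ℓ b)
    rw [Int.norm_eq_abs]
    exact_mod_cast Int.one_le_abs hb
  show ‖(max 1 ‖ℓ‖ : ℝ) ^ (-p)‖ ≤ ‖(⟨fun b => (ℓ b : ℝ), hmem ℓ⟩ : Λ)‖ ^ (-p)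
  rw [hnorm, max_eq_right h1, Real.norm_of_nonneg (by positivity)]

lemma volume_iUnion_le_ofReal_mul_tsum {ι : Type*} [Countable ι] {A : ι → Set ℝ} {w : ι → ℝ}
    (hw : ∀ i, 0 ≤ w i) (hs : Summable w) {c : ℝ} (hc : 0 ≤ c)
    (hA : ∀ i, MeasureTheory.volume (A i) ≤ ENNReal.ofReal (c * w i)) :
    MeasureTheory.volume (⋃ i, A i) ≤ ENNReal.ofReal (c * ∑' i, w i) := by
  refine (MeasureTheory.measure_iUnion_le A).trans ((ENNReal.tsum_le_tsum hA).trans_eq ?_)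
  rw [← ENNReal.ofReal_tsum_of_nonneg (fun i => mul_nonneg hc (hw i)) (hs.mul_left c),
    tsum_mul_left]

lemma rpow_half_facts {j : ℤ} (hj : j ≠ 0) :
    1 ≤ |(j : ℝ)| ^ ((1 : ℝ) / 2) ∧ (|(j : ℝ)| ^ ((1 : ℝ) / 2)) ^ 2 = |(j : ℝ)| ∧
      |(j : ℝ)| ^ ((3 : ℝ) / 2) = (|(j : ℝ)| ^ ((1 : ℝ) / 2)) ^ 3 := by
  have h1 : (1 : ℝ) ≤ |(j : ℝ)| := by exact_mod_cast Int.one_le_abs hj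
  refine ⟨Real.one_le_rpow h1 (by norm_num), ?_, ?_⟩ <;>
    · rw [← Real.rpow_natCast, ← Real.rpow_mul (abs_nonneg _)]
      norm_num

lemma abs_sub_le_abs_cube_sub {u v : ℝ} (hu : 1 ≤ u) (hv : 1 ≤ v) :
    |u - v| ≤ |u ^ 3 - v ^ 3| := by
  rw [show u ^ 3 - v ^ 3 = (u - v) * (u ^ 2 + u * v + v ^ 2) by ring, abs_mul]
  refine le_mul_of_one_le_right (abs_nonneg _) (le_trans ?_ (le_abs_self _))
  nlinarith

/-- If `u ^ 2` and `v ^ 2` differ by at least one, then `u` is controlled by `|u ^ 3 - v ^ 3|`. -/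
lemma le_two_mul_abs_cube_sub {u v : ℝ} (hu : 1 ≤ u) (hv : 1 ≤ v) (h : 1 ≤ |u ^ 2 - v ^ 2|) :
    u ≤ 2 * |u ^ 3 - v ^ 3| := by
  have h1 : |u ^ 3 - v ^ 3| * (u + v) = |u ^ 2 - v ^ 2| * (u ^ 2 + u * v + v ^ 2) := by
    rw [← abs_of_pos (by positivity : 0 < u + v), ← abs_mul,
      ← abs_of_pos (by positivity : 0 < u ^ 2 + u * v + v ^ 2), ← abs_mul]
    congr 1
    ring
  have h2 : u ^ 2 + u * v + v ^ 2 ≤ |u ^ 3 - v ^ 3| * (u + v) := by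
    rw [h1]
    exact le_mul_of_one_le_left (by positivity) h
  by_contra! hcon
  nlinarith

lemma HasDerivBounds.of_le_div_pow {m : ℕ} {s : Set ℝ} {f : ℝ → ℝ} {c υ : ℝ}
    (hf : ∀ x ∈ s, ContDiffAt ℝ ((m + 1 : ℕ) : WithTop ℕ∞) f x) (hc : 0 ≤ c) (hυ : 0 < υ)
    (hυ1 : υ ≤ 1) (e : ℕ → ℕ) (he : ∀ k ≤ m + 1, e k ≤ m + 2)
    (hb : ∀ k ≤ m + 1, ∀ x ∈ s, |iteratedDeriv k f x| ≤ c / υ ^ e k) :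
    HasDerivBounds (m + 1) s f (c / υ ^ (m + 2)) :=
  fun x hx => ⟨hf x hx, fun k hk => (hb k hk x hx).trans
    (div_le_div_of_nonneg_left hc (pow_pos hυ _)
      (pow_le_pow_of_le_one hυ.le hυ1 (he k hk)))⟩

lemma summable_max_one_norm_rpow_mul_one_div_sq (ν : ℕ) {t : ℝ} (ht : (ν : ℝ) + 4 < t) :
    Summable fun i : (Fin ν → ℤ) × ℤ =>
      (max 1 ‖i.1‖ : ℝ) ^ (-(t - 4)) * (1 / (i.2 : ℝ) ^ 2) :=
  (summable_max_one_norm_rpow ν (by linarith : (ν : ℝ) < t - 4)).mul_of_nonneg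
    (Real.summable_one_div_int_pow.mpr one_lt_two)
    (fun _ => Real.rpow_nonneg (by positivity) _) (fun _ => by positivity)

lemma volume_iUnion_le_of_abs_le {ν : ℕ} {t c q : ℝ} (ht : (ν : ℝ) + 4 < t) (hc : 0 ≤ c)
    {A : (Fin ν → ℤ) × ℤ → Set ℝ}
    (hA : ∀ ℓ j, (A (ℓ, j)).Nonempty → j ≠ 0 ∧ |(j : ℝ)| ≤ q * max 1 ‖ℓ‖ ^ 2 ∧
      MeasureTheory.volume (A (ℓ, j)) ≤ ENNReal.ofReal (c * max 1 ‖ℓ‖ ^ (-t))) :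
    MeasureTheory.volume (⋃ i, A i) ≤ ENNReal.ofReal (c * q ^ 2 *
      ∑' i : (Fin ν → ℤ) × ℤ, (max 1 ‖i.1‖ : ℝ) ^ (-(t - 4)) * (1 / (i.2 : ℝ) ^ 2)) := by
  refine volume_iUnion_le_ofReal_mul_tsum
    (fun i => mul_nonneg (Real.rpow_nonneg (by positivity) _) (by positivity))
    (summable_max_one_norm_rpow_mul_one_div_sq ν ht) (by positivity) ?_
  rintro ⟨ℓ, j⟩
  rcases (A (ℓ, j)).eq_empty_or_nonempty with h | h
  · simp [h]
  obtain ⟨hj, hjq, hvol⟩ := hA ℓ j h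
  refine hvol.trans (ENNReal.ofReal_le_ofReal ?_)
  have hL : (0 : ℝ) < max 1 ‖ℓ‖ := lt_max_of_lt_left one_pos
  have hj2 : 0 < (j : ℝ) ^ 2 := by positivity
  have hsq : (j : ℝ) ^ 2 ≤ q ^ 2 * max 1 ‖ℓ‖ ^ 4 := by
    calc (j : ℝ) ^ 2 = |(j : ℝ)| ^ 2 := (sq_abs _).symm
      _ ≤ (q * max 1 ‖ℓ‖ ^ 2) ^ 2 := by gcongr
      _ = _ := by ring
  have hpow : (max 1 ‖ℓ‖ : ℝ) ^ (-(t - 4)) = max 1 ‖ℓ‖ ^ (-t) * max 1 ‖ℓ‖ ^ 4 := by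
    rw [← Real.rpow_natCast, ← Real.rpow_add hL]
    congr 1
    push_cast
    ring
  have hLt : 0 ≤ (max 1 ‖ℓ‖ : ℝ) ^ (-t) := Real.rpow_nonneg hL.le _
  simp only [hpow]
  calc c * max 1 ‖ℓ‖ ^ (-t) = c * max 1 ‖ℓ‖ ^ (-t) * 1 := (mul_one _).symm
    _ ≤ c * max 1 ‖ℓ‖ ^ (-t) * (q ^ 2 * max 1 ‖ℓ‖ ^ 4 / (j : ℝ) ^ 2) := by
      gcongr
      rwa [one_le_div hj2]
    _ = _ := by ring

lemma abs_sum_mul_le_mul_max_one_norm {ν : ℕ} (jbar ℓ : Fin ν → ℤ) :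
    |((∑ b, jbar b * ℓ b : ℤ) : ℝ)| ≤ (∑ b, |(jbar b : ℝ)|) * max 1 ‖ℓ‖ := by
  push_cast
  refine (Finset.abs_sum_le_sum_abs _ _).trans ?_
  rw [Finset.sum_mul]
  refine Finset.sum_le_sum fun b _ => ?_
  rw [abs_mul]
  exact mul_le_mul_of_nonneg_left (abs_intCast_le_max_one_norm ℓ b) (abs_nonneg _)

/-- A bound on the difference of two dispersion weights controls the indices, if the indices differ
by `P`. -/
lemma abs_le_of_abs_rpow_sub_le {j j' : ℤ} (hj : j ≠ 0) (hj' : j' ≠ 0) (hne : j ≠ j')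
    {J Q L : ℝ} (hJ : 0 ≤ J) (hL : 1 ≤ L) (hP : |(j : ℝ) - j'| ≤ J * L)
    (h : |(|(j : ℝ)| ^ ((3 : ℝ) / 2) - |(j' : ℝ)| ^ ((3 : ℝ) / 2))| ≤ Q * L) :
    |(j : ℝ)| ≤ (4 * Q ^ 2 + J) * L ^ 2 := by
  have hLL : L ≤ L ^ 2 := by nlinarith
  by_cases habs : |j| = |j'|
  · obtain rfl : j = -j' := (abs_eq_abs.mp habs).resolve_left hne
    have h2 : |(((-j' : ℤ)) : ℝ) - j'| = 2 * |(((-j' : ℤ)) : ℝ)| := by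
      push_cast
      rw [show -(j' : ℝ) - j' = 2 * (-(j' : ℝ)) by ring, abs_mul, abs_two]
    rw [h2] at hP
    have := abs_nonneg (((-j' : ℤ)) : ℝ)
    nlinarith [mul_le_mul_of_nonneg_left hLL hJ, mul_nonneg (sq_nonneg Q) (sq_nonneg L)]
  · obtain ⟨hu, hu2, hu3⟩ := rpow_half_facts hj
    obtain ⟨hv, hv2, hv3⟩ := rpow_half_facts hj'
    have h1 : 1 ≤ |(|(j : ℝ)| ^ ((1 : ℝ) / 2)) ^ 2 - (|(j' : ℝ)| ^ ((1 : ℝ) / 2)) ^ 2| := by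
      rw [hu2, hv2]
      exact_mod_cast Int.one_le_abs (sub_ne_zero.mpr habs)
    have h3 := le_two_mul_abs_cube_sub hu hv h1
    rw [← hu3, ← hv3] at h3
    rw [← hu2]
    set u := |(j : ℝ)| ^ ((1 : ℝ) / 2)
    have h4 : u ≤ 2 * (Q * L) := by linarith
    calc u ^ 2 ≤ (2 * (Q * L)) ^ 2 := by gcongr
      _ = 4 * Q ^ 2 * L ^ 2 := by ring
      _ ≤ (4 * Q ^ 2 + J) * L ^ 2 := by gcongr; linarith

lemma abs_le_of_abs_rpow_add_le {j j' : ℤ} (hj : j ≠ 0) {Q L : ℝ} (hQ : 0 ≤ Q) (hL : 1 ≤ L)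
    (h : |(|(j : ℝ)| ^ ((3 : ℝ) / 2) + |(j' : ℝ)| ^ ((3 : ℝ) / 2))| ≤ Q * L) :
    |(j : ℝ)| ≤ Q * L ^ 2 := by
  obtain ⟨hu, hu2, hu3⟩ := rpow_half_facts hj
  have h1 := (le_abs_self _).trans h
  have h2 : 0 ≤ |(j' : ℝ)| ^ ((3 : ℝ) / 2) := by positivity
  rw [hu3] at h1
  rw [← hu2]
  set u := |(j : ℝ)| ^ ((1 : ℝ) / 2)
  have h3 : u ^ 2 ≤ u ^ 3 := pow_le_pow_right₀ hu (by norm_num)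
  have h4 : Q * L ≤ Q * L ^ 2 := mul_le_mul_of_nonneg_left (by nlinarith) hQ
  linarith

set_option maxHeartbeats 1000000 in
/-- Measure estimate for the good parameter set G_ε. -/
theorem measure_estimate_good_set
    (dpt g γ κ₁ κ₂ : ℝ) (hdpt : 0 < dpt) (hg : 0 < g) (hκ₁ : 0 < κ₁) (hκ₁₂ : κ₁ < κ₂)
    (ν : ℕ) (hν : 1 ≤ ν) (jbar : Fin ν → ℤ)
    (hjne : ∀ b, jbar b ≠ 0)
    (hjinj : Function.Injective fun b => |jbar b|)
    (m₀ : ℕ) (hm₀ : 1 ≤ m₀) (ρ₀ : ℝ) (hρ₀ : 0 < ρ₀) (C₀ : ℝ) (hC₀ : 0 < C₀)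
    (τ a : ℝ) (hτ : (m₀ : ℝ) * ((ν : ℝ) + 4) < τ)
    (ha0 : 0 < a) (ha1 : a < 1 / (1 + ((m₀ : ℝ) + 2)))
    (htrans0 : ∀ κ ∈ Set.Icc κ₁ κ₂, ∀ ℓ : Fin ν → ℤ, ℓ ≠ 0 →
      ∃ n ≤ m₀, ρ₀ * max 1 ‖ℓ‖ ≤
        |iteratedDeriv n (fun κ' => ∑ b, (ℓ b : ℝ) * OmegaF dpt g γ (jbar b) κ') κ|)
    (htrans1 : ∀ κ ∈ Set.Icc κ₁ κ₂, ∀ ℓ : Fin ν → ℤ, ∀ j : ℤ,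
      j ≠ 0 → (∀ b, j ≠ jbar b) → (∑ b, jbar b * ℓ b) + j = 0 →
      ∃ n ≤ m₀, ρ₀ * max 1 ‖ℓ‖ ≤
        |iteratedDeriv n
          (fun κ' => (∑ b, (ℓ b : ℝ) * OmegaF dpt g γ (jbar b) κ') + OmegaF dpt g γ j κ') κ|)
    (htrans2 : ∀ κ ∈ Set.Icc κ₁ κ₂, ∀ ℓ : Fin ν → ℤ, ∀ j j' : ℤ,
      j ≠ 0 → (∀ b, j ≠ jbar b) → j' ≠ 0 → (∀ b, j' ≠ jbar b) →
      ¬(ℓ = 0 ∧ j = j') → (∑ b, jbar b * ℓ b) + j - j' = 0 →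
      ∃ n ≤ m₀, ρ₀ * max 1 ‖ℓ‖ ≤
        |iteratedDeriv n
          (fun κ' => (∑ b, (ℓ b : ℝ) * OmegaF dpt g γ (jbar b) κ')
            + OmegaF dpt g γ j κ' - OmegaF dpt g γ j' κ') κ|)
    (htrans3 : ∀ κ ∈ Set.Icc κ₁ κ₂, ∀ ℓ : Fin ν → ℤ, ∀ j j' : ℤ,
      j ≠ 0 → (∀ b, j ≠ jbar b) → j' ≠ 0 → (∀ b, j' ≠ jbar b) →
      (∑ b, jbar b * ℓ b) + j + j' = 0 →
      ∃ n ≤ m₀, ρ₀ * max 1 ‖ℓ‖ ≤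
        |iteratedDeriv n
          (fun κ' => (∑ b, (ℓ b : ℝ) * OmegaF dpt g γ (jbar b) κ')
            + OmegaF dpt g γ j κ' + OmegaF dpt g γ j' κ') κ|) :
    ∃ ε₀ > (0 : ℝ), ∃ C > (0 : ℝ), ∀ ε : ℝ, 0 < ε → ε < ε₀ →
      ∀ (m32 m1 m12 : ℝ → ℝ) (r : ℤ → ℝ → ℝ) (ωε : ℝ → Fin ν → ℝ),
      ContDiff ℝ (m₀ + 2) m32 → ContDiff ℝ (m₀ + 2) m1 → ContDiff ℝ (m₀ + 2) m12 →
      (∀ j : ℤ, j ≠ 0 → (∀ b, j ≠ jbar b) → ContDiff ℝ (m₀ + 2) (r j)) →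
      (∀ b, ContDiff ℝ (m₀ + 2) fun κ => ωε κ b) →
      (∀ k ≤ m₀ + 2, ∀ κ ∈ Set.Icc κ₁ κ₂,
        |iteratedDeriv k (fun κ' => m32 κ' - 1) κ| ≤ C₀ * ε / (ε ^ a) ^ k ∧
        |iteratedDeriv k m1 κ| ≤ C₀ * ε / (ε ^ a) ^ k ∧
        |iteratedDeriv k m12 κ| ≤ C₀ * ε / (ε ^ a) ^ k ∧
        (∀ j : ℤ, j ≠ 0 → (∀ b, j ≠ jbar b) →
          |iteratedDeriv k (r j) κ| ≤ C₀ * ε / (ε ^ a) ^ (1 + k)) ∧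
        (∀ b, |iteratedDeriv k (fun κ' => ωε κ' b - OmegaF dpt g γ (jbar b) κ') κ| ≤
          C₀ * ε / (ε ^ a) ^ (1 + k))) →
      MeasureTheory.volume (Set.Icc κ₁ κ₂ \
        {κ | (∀ ℓ : Fin ν → ℤ, ℓ ≠ 0 →
                8 * ε ^ a * (max 1 ‖ℓ‖) ^ (-τ) ≤ |∑ b, (ℓ b : ℝ) * ωε κ b|) ∧
             (∀ (ℓ : Fin ν → ℤ) (j : ℤ), j ≠ 0 → (∀ b, j ≠ jbar b) →
                (∑ b, jbar b * ℓ b) + j = 0 →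
                4 * ε ^ a * |(j : ℝ)| ^ ((3 : ℝ) / 2) * (max 1 ‖ℓ‖) ^ (-τ) ≤
                  |(∑ b, (ℓ b : ℝ) * ωε κ b) + muF dpt g γ m32 m1 m12 r j κ|) ∧
             (∀ (ℓ : Fin ν → ℤ) (j j' : ℤ),
                j ≠ 0 → (∀ b, j ≠ jbar b) → j' ≠ 0 → (∀ b, j' ≠ jbar b) →
                ¬(ℓ = 0 ∧ j = j') → (∑ b, jbar b * ℓ b) + j - j' = 0 →
                4 * ε ^ a * max 1 |(|(j : ℝ)| ^ ((3 : ℝ) / 2) - |(j' : ℝ)| ^ ((3 : ℝ) / 2))|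
                    * (max 1 ‖ℓ‖) ^ (-τ) ≤
                  |(∑ b, (ℓ b : ℝ) * ωε κ b) + muF dpt g γ m32 m1 m12 r j κ
                    - muF dpt g γ m32 m1 m12 r j' κ|) ∧
             (∀ (ℓ : Fin ν → ℤ) (j j' : ℤ),
                j ≠ 0 → (∀ b, j ≠ jbar b) → j' ≠ 0 → (∀ b, j' ≠ jbar b) →
                (∑ b, jbar b * ℓ b) + j + j' = 0 →
                4 * ε ^ a * (|(j : ℝ)| ^ ((3 : ℝ) / 2) + |(j' : ℝ)| ^ ((3 : ℝ) / 2))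
                    * (max 1 ‖ℓ‖) ^ (-τ) ≤
                  |(∑ b, (ℓ b : ℝ) * ωε κ b) + muF dpt g γ m32 m1 m12 r j κ
                    + muF dpt g γ m32 m1 m12 r j' κ|)}) ≤
        ENNReal.ofReal (C * ε ^ (a / (m₀ : ℝ))) := by
  have hm : (0 : ℝ) < m₀ := by exact_mod_cast hm₀
  have hτ0 : 0 < τ := lt_trans (by positivity) hτ
  set t : ℝ := τ / m₀ with ht
  have htν : (ν : ℝ) + 4 < t := by rwa [ht, lt_div_iff₀ hm, mul_comm]
  set J : ℝ := ∑ b, |(jbar b : ℝ)| with hJ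
  have hJ0 : 0 ≤ J := Finset.sum_nonneg fun b _ => abs_nonneg _
  obtain ⟨η₀, hη₀, υ₀, hυ₀, C, hC, Q, hQ, hdiv⟩ :=
    exists_volume_divisor_le γ hdpt hg hκ₁ hκ₁₂ hjne m₀ hρ₀ hJ0
  have hs0 : 0 < 1 - a * ((m₀ + 2 : ℕ) : ℝ) := by
    rw [lt_div_iff₀ (by positivity)] at ha1
    push_cast
    linarith
  obtain ⟨ε₁, hε₁, hη⟩ := exists_forall_rpow_le hs0 (div_pos hη₀ hC₀)
  obtain ⟨ε₂, hε₂, hυ⟩ := exists_forall_rpow_le ha0 hυ₀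
  set q : ℝ := 4 * Q ^ 2 + J + Q with hq
  set S₀ : ℝ := ∑' ℓ : Fin ν → ℤ, (max 1 ‖ℓ‖ : ℝ) ^ (-t) with hS₀
  set S₁ : ℝ := ∑' i : (Fin ν → ℤ) × ℤ,
    (max 1 ‖i.1‖ : ℝ) ^ (-(t - 4)) * (1 / (i.2 : ℝ) ^ 2) with hS₁
  have hS₀0 : 0 ≤ S₀ := tsum_nonneg fun ℓ => Real.rpow_nonneg (by positivity) _
  have hS₁0 : 0 ≤ S₁ := tsum_nonneg fun i =>
    mul_nonneg (Real.rpow_nonneg (by positivity) _) (by positivity)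
  refine ⟨min 1 (min ε₁ ε₂), by positivity, C * (2 * S₀ + 2 * (q ^ 2 * S₁)) + 1, by positivity, ?_⟩
  intro ε hε hlt m32 m1 m12 r ωε cm32 cm1 cm12 cr cω hbd
  obtain ⟨hε1, hlt'⟩ := lt_min_iff.mp hlt
  obtain ⟨hεη, hευ⟩ := lt_min_iff.mp hlt'
  have hυpos : 0 < ε ^ a := Real.rpow_pos_of_pos hε a
  have hυ1 : ε ^ a ≤ 1 := Real.rpow_le_one hε.le hε1.le ha0.le
  set η : ℝ := C₀ * ε / (ε ^ a) ^ (m₀ + 2) with hηdef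
  have hη0 : 0 ≤ η := by positivity
  have hηle : η ≤ η₀ := by
    have h1 : η = C₀ * ε ^ (1 - a * ((m₀ + 2 : ℕ) : ℝ)) := by
      rw [hηdef, Real.rpow_sub hε, Real.rpow_one, Real.rpow_mul hε.le, Real.rpow_natCast]
      ring
    have h2 := hη ε hε hεη
    rw [le_div_iff₀ hC₀] at h2
    rw [h1]
    linarith
  have hcε : 0 ≤ C₀ * ε := by positivity
  have hcast : ((m₀ + 1 : ℕ) : WithTop ℕ∞) ≤ (m₀ : WithTop ℕ∞) + 2 := by
    exact_mod_cast Nat.le_succ (m₀ + 1)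
  have bm32 : HasDerivBounds (m₀ + 1) (Set.Icc κ₁ κ₂) (fun κ => m32 κ - 1) η :=
    .of_le_div_pow (fun x _ => ((cm32.sub contDiff_const).of_le hcast).contDiffAt) hcε hυpos hυ1 id
      (fun k hk => by simp only [id]; omega) fun k hk x hx => (hbd k (by omega) x hx).1
  have bm1 : HasDerivBounds (m₀ + 1) (Set.Icc κ₁ κ₂) m1 η :=
    .of_le_div_pow (fun x _ => (cm1.of_le hcast).contDiffAt) hcε hυpos hυ1 id
      (fun k hk => by simp only [id]; omega) fun k hk x hx => (hbd k (by omega) x hx).2.1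
  have bm12 : HasDerivBounds (m₀ + 1) (Set.Icc κ₁ κ₂) m12 η :=
    .of_le_div_pow (fun x _ => (cm12.of_le hcast).contDiffAt) hcε hυpos hυ1 id
      (fun k hk => by simp only [id]; omega) fun k hk x hx => (hbd k (by omega) x hx).2.2.1
  have br : ∀ j : ℤ, j ≠ 0 → (∀ b, j ≠ jbar b) →
      HasDerivBounds (m₀ + 1) (Set.Icc κ₁ κ₂) (r j) η := fun j hj hjb =>
    .of_le_div_pow (fun x _ => ((cr j hj hjb).of_le hcast).contDiffAt) hcε hυpos hυ1 (1 + ·)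
      (fun k hk => by omega)
      fun k hk x hx => (hbd k (by omega) x hx).2.2.2.1 j hj hjb
  have bω : ∀ b, HasDerivBounds (m₀ + 1) (Set.Icc κ₁ κ₂)
      (fun κ => ωε κ b - OmegaF dpt g γ (jbar b) κ) η := by
    intro b
    obtain ⟨B, hB⟩ := exists_hasDerivBounds_OmegaF (m₀ + 1) γ κ₂ hdpt hg hκ₁ hκ₁₂ (hjne b)
    exact .of_le_div_pow (fun x hx => ((cω b).of_le hcast).contDiffAt.sub (hB x hx).1)
      hcε hυpos hυ1 (1 + ·) (fun k hk => by omega)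
      fun k hk x hx => (hbd k (by omega) x hx).2.2.2.2 b
  set c : ℝ := C * ε ^ (a / (m₀ : ℝ)) with hc
  have hc0 : 0 ≤ c := by positivity
  set D : ℝ → ℝ → (Fin ν → ℤ) → ℤ → ℤ → Set ℝ := fun σ σ' ℓ j j' =>
    {κ ∈ Set.Icc κ₁ κ₂ | |(∑ b, (ℓ b : ℝ) * ωε κ b) +
      (σ * muF dpt g γ m32 m1 m12 r j κ + σ' * muF dpt g γ m32 m1 m12 r j' κ)| ≤
      8 * ε ^ a * max 1 |σ * |(j : ℝ)| ^ ((3 : ℝ) / 2) + σ' * |(j' : ℝ)| ^ ((3 : ℝ) / 2)| *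
        (max 1 ‖ℓ‖) ^ (-τ)} with hD
  have hL : ∀ ℓ : Fin ν → ℤ, (1 : ℝ) ≤ max 1 ‖ℓ‖ := fun ℓ => le_max_left _ _
  have hw0 : ∀ ℓ : Fin ν → ℤ, (0 : ℝ) < max 1 ‖ℓ‖ ^ (-τ) := fun ℓ =>
    Real.rpow_pos_of_pos (one_pos.trans_le (hL ℓ)) _
  have hDvol : ∀ (ℓ : Fin ν → ℤ) (σ σ' : ℝ) (j j' : ℤ), |σ| ≤ 1 → |σ'| ≤ 1 → j ≠ 0 → j' ≠ 0 →
      HasDerivBounds (m₀ + 1) (Set.Icc κ₁ κ₂) (fun κ => σ * r j κ + σ' * r j' κ) (2 * η) →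
      |σ * j + σ' * j'| ≤ J * max 1 ‖ℓ‖ →
      |σ * |(j : ℝ)| ^ ((1 : ℝ) / 2) + σ' * |(j' : ℝ)| ^ ((1 : ℝ) / 2)| ≤
        |σ * |(j : ℝ)| ^ ((3 : ℝ) / 2) + σ' * |(j' : ℝ)| ^ ((3 : ℝ) / 2)| →
      (∀ κ ∈ Set.Icc κ₁ κ₂, ∃ n ≤ m₀, ρ₀ * max 1 ‖ℓ‖ ≤
        |iteratedDeriv n (fun κ' => (∑ b, (ℓ b : ℝ) * OmegaF dpt g γ (jbar b) κ') +
          (σ * OmegaF dpt g γ j κ' + σ' * OmegaF dpt g γ j' κ')) κ|) →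
      ((D σ σ' ℓ j j').Nonempty →
        |σ * |(j : ℝ)| ^ ((3 : ℝ) / 2) + σ' * |(j' : ℝ)| ^ ((3 : ℝ) / 2)| ≤ Q * max 1 ‖ℓ‖) ∧
      MeasureTheory.volume (D σ σ' ℓ j j') ≤ ENNReal.ofReal (c * max 1 ‖ℓ‖ ^ (-t)) := by
    intro ℓ σ σ' j j' hσ hσ' hj hj' hR hP hH htr
    have h := hdiv η (ε ^ a) hη0 hηle hυpos (hυ ε hε hευ) m32 m1 m12 r ωε bm32 bm1 bm12 bω
      ℓ σ σ' j j' (max 1 ‖ℓ‖ ^ (-τ)) hσ hσ' hj hj' (hw0 ℓ)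
      (Real.rpow_le_one_of_one_le_of_nonpos (hL ℓ) (by linarith)) hR hP hH htr
    refine ⟨h.1, h.2.trans_eq ?_⟩
    congr 1
    rw [Real.mul_rpow hυpos.le (hw0 ℓ).le, ← Real.rpow_mul hε.le,
      ← Real.rpow_mul (one_pos.trans_le (hL ℓ)).le, hc, ht, mul_assoc]
    congr 3 <;> ring
  have hPℓ : ∀ ℓ : Fin ν → ℤ, |((∑ b, jbar b * ℓ b : ℤ) : ℝ)| ≤ J * max 1 ‖ℓ‖ :=
    abs_sum_mul_le_mul_max_one_norm jbar
  have hqJ : 4 * Q ^ 2 + J ≤ q := by linarith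
  have hqQ : Q ≤ q := by nlinarith [sq_nonneg Q]
  set ok : ℤ → Prop := fun j => j ≠ 0 ∧ ∀ b, j ≠ jbar b with hok
  have hA0 : MeasureTheory.volume (⋃ ℓ : Fin ν → ℤ, {κ | ℓ ≠ 0 ∧ κ ∈ D 0 0 ℓ 1 1}) ≤
      ENNReal.ofReal (c * S₀) := by
    refine volume_iUnion_le_ofReal_mul_tsum (fun ℓ => Real.rpow_nonneg (by positivity) _)
      (summable_max_one_norm_rpow ν (by linarith)) hc0 fun ℓ => ?_
    by_cases hℓ : ℓ = 0
    · simp [hℓ]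
    refine (MeasureTheory.measure_mono fun κ hκ => hκ.2).trans (hDvol ℓ 0 0 1 1 (by simp) (by simp)
      one_ne_zero one_ne_zero ?_ ?_ ?_ ?_).2
    · simpa using (HasDerivBounds.const (m₀ + 1) (Set.Icc κ₁ κ₂) 0).mono (by simpa using hη0)
    · simpa using (abs_nonneg _).trans (hPℓ ℓ)
    · simp
    · intro κ hκ
      simpa using htrans0 κ hκ ℓ hℓ
  have hA1 : MeasureTheory.volume (⋃ ℓ : Fin ν → ℤ, {κ | ok (-∑ b, jbar b * ℓ b) ∧
      κ ∈ D 1 0 ℓ (-∑ b, jbar b * ℓ b) 1}) ≤ ENNReal.ofReal (c * S₀) := by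
    refine volume_iUnion_le_ofReal_mul_tsum (fun ℓ => Real.rpow_nonneg (by positivity) _)
      (summable_max_one_norm_rpow ν (by linarith)) hc0 fun ℓ => ?_
    generalize hj : -∑ b, jbar b * ℓ b = j
    have hPj : (∑ b, jbar b * ℓ b) + j = 0 := by omega
    by_cases hokj : ok j
    swap
    · simp [hokj]
    obtain ⟨hu, hu2, hu3⟩ := rpow_half_facts hokj.1
    refine (MeasureTheory.measure_mono fun κ hκ => hκ.2).trans (hDvol ℓ 1 0 j 1 (by simp) (by simp)
      hokj.1 one_ne_zero ?_ ?_ ?_ ?_).2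
    · simpa using (br j hokj.1 hokj.2).mono (by linarith : η ≤ 2 * η)
    · have h := hPℓ ℓ
      rw [← abs_neg, ← Int.cast_neg, hj] at h
      simpa using h
    · simp only [one_mul, zero_mul, add_zero, hu3]
      set u := |(j : ℝ)| ^ ((1 : ℝ) / 2)
      rw [abs_of_nonneg (by linarith), abs_of_nonneg (by positivity)]
      exact le_self_pow₀ hu (by norm_num)
    · intro κ hκ
      simpa using htrans1 κ hκ ℓ j hokj.1 hokj.2 hPj
  have hA2 : MeasureTheory.volume (⋃ i : (Fin ν → ℤ) × ℤ, {κ | ok i.2 ∧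
      ok (i.2 + ∑ b, jbar b * i.1 b) ∧ i.2 ≠ i.2 + ∑ b, jbar b * i.1 b ∧
      κ ∈ D 1 (-1) i.1 i.2 (i.2 + ∑ b, jbar b * i.1 b)}) ≤ ENNReal.ofReal (c * q ^ 2 * S₁) := by
    refine volume_iUnion_le_of_abs_le htν hc0 fun ℓ j => ?_
    dsimp only
    generalize hj' : j + ∑ b, jbar b * ℓ b = j'
    rintro ⟨κ₀, hκj, hκj', hne, hκD⟩
    have hPj : (∑ b, jbar b * ℓ b) + j - j' = 0 := by omega
    obtain ⟨hu, hu2, hu3⟩ := rpow_half_facts hκj.1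
    obtain ⟨hv, hv2, hv3⟩ := rpow_half_facts hκj'.1
    have hP : |(j : ℝ) - j'| ≤ J * max 1 ‖ℓ‖ := by
      have h := hPℓ ℓ
      rw [show ∑ b, jbar b * ℓ b = j' - j by omega] at h
      rw [abs_sub_comm]
      simpa using h
    have h := hDvol ℓ 1 (-1) j j' (by simp) (by simp) hκj.1 hκj'.1 ?_ ?_ ?_ ?_
    · refine ⟨hκj.1, ?_, (MeasureTheory.measure_mono fun κ hκ => hκ.2.2.2).trans h.2⟩
      have h1 := h.1 ⟨κ₀, hκD⟩
      simp only [one_mul, neg_mul, ← sub_eq_add_neg] at h1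
      exact (abs_le_of_abs_rpow_sub_le hκj.1 hκj'.1 hne hJ0 (hL ℓ) hP h1).trans (by gcongr)
    · have h1 := ((br j hκj.1 hκj.2).const_mul 1).add ((br j' hκj'.1 hκj'.2).const_mul (-1))
      exact h1.mono (by simp; linarith)
    · simpa [← sub_eq_add_neg] using hP
    · simp only [one_mul, neg_mul, ← sub_eq_add_neg, hu3, hv3]
      exact abs_sub_le_abs_cube_sub hu hv
    · intro κ hκ
      have h1 := htrans2 κ hκ ℓ j j' hκj.1 hκj.2 hκj'.1 hκj'.2 (fun h => hne h.2) hPj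
      simpa only [one_mul, neg_mul, ← sub_eq_add_neg, ← add_sub_assoc] using h1
  have hA3 : MeasureTheory.volume (⋃ i : (Fin ν → ℤ) × ℤ, {κ | ok i.2 ∧
      ok (-i.2 - ∑ b, jbar b * i.1 b) ∧
      κ ∈ D 1 1 i.1 i.2 (-i.2 - ∑ b, jbar b * i.1 b)}) ≤ ENNReal.ofReal (c * q ^ 2 * S₁) := by
    refine volume_iUnion_le_of_abs_le htν hc0 fun ℓ j => ?_
    dsimp only
    generalize hj' : -j - ∑ b, jbar b * ℓ b = j'
    rintro ⟨κ₀, hκj, hκj', hκD⟩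
    have hPj : (∑ b, jbar b * ℓ b) + j + j' = 0 := by omega
    obtain ⟨hu, hu2, hu3⟩ := rpow_half_facts hκj.1
    obtain ⟨hv, hv2, hv3⟩ := rpow_half_facts hκj'.1
    have h := hDvol ℓ 1 1 j j' (by simp) (by simp) hκj.1 hκj'.1 ?_ ?_ ?_ ?_
    · refine ⟨hκj.1, ?_, (MeasureTheory.measure_mono fun κ hκ => hκ.2.2).trans h.2⟩
      have h1 := h.1 ⟨κ₀, hκD⟩
      simp only [one_mul] at h1
      exact (abs_le_of_abs_rpow_add_le hκj.1 hQ.le (hL ℓ) h1).trans (by gcongr)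
    · have h1 := ((br j hκj.1 hκj.2).const_mul 1).add ((br j' hκj'.1 hκj'.2).const_mul 1)
      exact h1.mono (by simp; linarith)
    · have h1 := hPℓ ℓ
      rw [show ∑ b, jbar b * ℓ b = -(j + j') by omega] at h1
      simpa only [Int.cast_neg, abs_neg, Int.cast_add, one_mul] using h1
    · simp only [one_mul, hu3, hv3]
      set u := |(j : ℝ)| ^ ((1 : ℝ) / 2)
      set v := |(j' : ℝ)| ^ ((1 : ℝ) / 2)
      rw [abs_of_nonneg (by linarith), abs_of_nonneg (by positivity)]
      exact add_le_add (le_self_pow₀ hu (by norm_num)) (le_self_pow₀ hv (by norm_num))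
    · intro κ hκ
      have h1 := htrans3 κ hκ ℓ j j' hκj.1 hκj.2 hκj'.1 hκj'.2 hPj
      simpa only [one_mul, ← add_assoc] using h1
  have hbound : ENNReal.ofReal (c * S₀) + ENNReal.ofReal (c * S₀) +
      ENNReal.ofReal (c * q ^ 2 * S₁) + ENNReal.ofReal (c * q ^ 2 * S₁) ≤
      ENNReal.ofReal ((C * (2 * S₀ + 2 * (q ^ 2 * S₁)) + 1) * ε ^ (a / (m₀ : ℝ))) := by
    rw [← ENNReal.ofReal_add (by positivity) (by positivity),
      ← ENNReal.ofReal_add (by positivity) (by positivity),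
      ← ENNReal.ofReal_add (by positivity) (by positivity)]
    refine ENNReal.ofReal_le_ofReal ?_
    have h1 : 0 ≤ ε ^ (a / (m₀ : ℝ)) := by positivity
    rw [hc]
    linarith
  refine (MeasureTheory.measure_mono ?_).trans
    (((MeasureTheory.measure_union_le _ _).trans (add_le_add
      ((MeasureTheory.measure_union_le _ _).trans (add_le_add
        ((MeasureTheory.measure_union_le _ _).trans (add_le_add hA0 hA1)) hA2)) hA3)).trans hbound)
  rintro κ ⟨hκ, hκG⟩
  by_contra hcon
  simp only [Set.mem_union, Set.mem_iUnion, Set.mem_ofPred_eq, not_or, not_exists] at hcon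
  obtain ⟨⟨⟨hn0, hn1⟩, hn2⟩, hn3⟩ := hcon
  have h4 : ∀ (ℓ : Fin ν → ℤ) (x y : ℝ), x ≤ 2 * max 1 |y| →
      4 * ε ^ a * x * max 1 ‖ℓ‖ ^ (-τ) ≤ 8 * ε ^ a * max 1 |y| * max 1 ‖ℓ‖ ^ (-τ) := by
    intro ℓ x y h
    have := hw0 ℓ
    refine mul_le_mul_of_nonneg_right ?_ this.le
    nlinarith
  have h0 : ∀ ℓ : Fin ν → ℤ, ℓ ≠ 0 →
      8 * ε ^ a * (max 1 ‖ℓ‖) ^ (-τ) ≤ |∑ b, (ℓ b : ℝ) * ωε κ b| := by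
    intro ℓ hℓ
    by_contra! hlt0
    exact hn0 ℓ ⟨hℓ, hκ, by simpa using hlt0.le⟩
  refine hκG ⟨h0, ?_, ?_, ?_⟩
  · intro ℓ j hj hjb hPj
    by_contra! hlt1
    obtain rfl : j = -∑ b, jbar b * ℓ b := by omega
    refine hn1 ℓ ⟨⟨hj, hjb⟩, hκ, ?_⟩
    rw [one_mul, zero_mul, add_zero]
    refine hlt1.le.trans (h4 ℓ _ _ ?_)
    rw [one_mul, zero_mul, add_zero]
    have h1 := le_abs_self (|((-∑ b, jbar b * ℓ b : ℤ) : ℝ)| ^ ((3 : ℝ) / 2))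
    have h2 := le_max_right (1 : ℝ) |(|((-∑ b, jbar b * ℓ b : ℤ) : ℝ)| ^ ((3 : ℝ) / 2))|
    have h3 := abs_nonneg (|((-∑ b, jbar b * ℓ b : ℤ) : ℝ)| ^ ((3 : ℝ) / 2))
    linarith
  · intro ℓ j j' hj hjb hj' hjb' hne hPj
    by_cases hjj : j = j'
    · subst hjj
      have h1 := h0 ℓ fun h => hne ⟨h, rfl⟩
      have := mul_pos hυpos (hw0 ℓ)
      rw [add_sub_cancel_right, sub_self, abs_zero, max_eq_left zero_le_one]
      linarith
    by_contra! hlt2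
    obtain rfl : j' = j + ∑ b, jbar b * ℓ b := by omega
    refine hn2 (ℓ, j) ⟨⟨hj, hjb⟩, ⟨hj', hjb'⟩, hjj, hκ, ?_⟩
    simp only [one_mul, neg_mul, ← sub_eq_add_neg, ← add_sub_assoc]
    refine hlt2.le.trans (h4 ℓ _ _ ?_)
    linarith [le_max_left (1 : ℝ) |(|(j : ℝ)| ^ ((3 : ℝ) / 2) -
      |((j + ∑ b, jbar b * ℓ b : ℤ) : ℝ)| ^ ((3 : ℝ) / 2))|]
  · intro ℓ j j' hj hjb hj' hjb' hPj
    by_contra! hlt3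
    obtain rfl : j' = -j - ∑ b, jbar b * ℓ b := by omega
    refine hn3 (ℓ, j) ⟨⟨hj, hjb⟩, ⟨hj', hjb'⟩, hκ, ?_⟩
    simp only [one_mul, ← add_assoc]
    refine hlt3.le.trans (h4 ℓ _ _ ?_)
    set x := |(j : ℝ)| ^ ((3 : ℝ) / 2) + |((-j - ∑ b, jbar b * ℓ b : ℤ) : ℝ)| ^ ((3 : ℝ) / 2)
    linarith [le_abs_self x, le_max_right 1 |x|, abs_nonneg x]
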